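/- Let 1 < q < ∞ and 1 < r < ∞, and set A_{q,r} := e^{1/q - 1/r} · ((q-1)/q) / (Γ(1+1/r) r^{1/r}) · ( Γ(r+1+q/(q-1)) / (Γ(r+1) Γ(1+q/(q-1))) )^{1/r}. Then for every t > 0: if A_{q,r} t > 1 then vol_n(D_{q,1}^n ∩ t D_r^n) → 1 as n → ∞, while if A_{q,r} t < 1 then vol_n(D_{q,1}^n ∩ t D_r^n) → 0 as n → ∞. -/

import Mathlib

open MeasureTheory Finset Filter
open scoped ENNReal NNReal

noncomputable section

/-- `sortedAbs x i` is the `i`-th largest value among `|x 0|, …, |x (n-1)|`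
(`i = 0` gives the largest), i.e. the non-increasing rearrangement of `|x|`. -/
def sortedAbs {n : ℕ} (x : Fin n → ℝ) (i : Fin n) : ℝ :=
  |x (Tuple.sort (fun j => |x j|) i.rev)|

/-- The Lorentz norm `‖x‖_{q,1} = ∑_{i=1}^n i^{1/q-1} x_i^*` for `1 < q < ∞`. -/
def lorentzNorm (q : ℝ) {n : ℕ} (x : Fin n → ℝ) : ℝ :=
  ∑ i : Fin n, ((i : ℝ) + 1) ^ (1 / q - 1) * sortedAbs x i

/-- The unit ball of the Lorentz space `ℓ_{q,1}^n`. -/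
def lorentzBall (q : ℝ) (n : ℕ) : Set (Fin n → ℝ) :=
  {x | lorentzNorm q x ≤ 1}

/-- The volume-normalized Lorentz ball `D_{q,1}^n = vol_n(B_{q,1}^n)^{-1/n} B_{q,1}^n`. -/
def volNormLorentzBall (q : ℝ) (n : ℕ) : Set (Fin n → ℝ) :=
  (fun x => ((volume (lorentzBall q n)).toReal ^ (-(1 : ℝ) / n)) • x) '' lorentzBall q n

/-- The unit ball of `ℓ_r^n`. -/
def ellrBall (r : ℝ) (n : ℕ) : Set (Fin n → ℝ) :=
  {x | ∑ i : Fin n, |x i| ^ r ≤ 1}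

/-- The volume-normalized `ℓ_r^n` ball `D_r^n = vol_n(B_r^n)^{-1/n} B_r^n`. -/
def volNormEllrBall (r : ℝ) (n : ℕ) : Set (Fin n → ℝ) :=
  (fun x => ((volume (ellrBall r n)).toReal ^ (-(1 : ℝ) / n)) • x) '' ellrBall r n

/-- The threshold constant `A_{q,r}`. -/
def Aqr (q r : ℝ) : ℝ :=
  Real.exp (1 / q - 1 / r) * ((q - 1) / q) / (Real.Gamma (1 + 1 / r) * r ^ (1 / r)) *
    (Real.Gamma (r + 1 + q / (q - 1)) / (Real.Gamma (r + 1) * Real.Gamma (1 + q / (q - 1))))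
      ^ (1 / r)

def signedPerm {n : ℕ} (g : Equiv.Perm (Fin n) × (Fin n → ℤˣ)) (x : Fin n → ℝ) : Fin n → ℝ :=
  fun i => ((g.2 i : ℤ) : ℝ) * x (g.1 i)

def orderCone (n : ℕ) : Set (Fin n → ℝ) := {x | (∀ i, 0 ≤ x i) ∧ Antitone x}

lemma measurePreserving_signedPerm {n : ℕ} (g : Equiv.Perm (Fin n) × (Fin n → ℤˣ)) :
    MeasurePreserving (signedPerm g) volume volume := by
  have h1 : MeasurePreserving (fun x : Fin n → ℝ => fun i => x (g.1 i)) volume volume :=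
    volume_preserving_arrowCongr' g.1.symm (MeasurableEquiv.refl ℝ) (MeasurePreserving.id _)
  have h2 : MeasurePreserving (fun x : Fin n → ℝ => fun i => ((g.2 i : ℤ) : ℝ) * x i)
      volume volume := by
    refine volume_preserving_pi (f := fun i (a : ℝ) => ((g.2 i : ℤ) : ℝ) * a) fun i => ?_
    rcases Int.units_eq_one_or (g.2 i) with h | h
    · simp only [h, Units.val_one, Int.cast_one, one_mul]
      exact MeasurePreserving.id _
    · simp only [h, Units.val_neg, Units.val_one, Int.cast_neg, Int.cast_one, neg_mul, one_mul]
      exact Measure.measurePreserving_neg _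
  exact h2.comp h1

lemma abs_signedPerm {n : ℕ} (g : Equiv.Perm (Fin n) × (Fin n → ℤˣ)) (x : Fin n → ℝ) (i : Fin n) :
    |signedPerm g x i| = |x (g.1 i)| := by
  rcases Int.units_eq_one_or (g.2 i) with h | h <;> simp [signedPerm, h]

lemma signedPerm_eq_abs {n : ℕ} {g : Equiv.Perm (Fin n) × (Fin n → ℤˣ)} {x : Fin n → ℝ}
    (h : signedPerm g x ∈ orderCone n) (i : Fin n) : signedPerm g x i = |x (g.1 i)| := by
  rw [← abs_signedPerm, abs_of_nonneg (h.1 i)]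

lemma volume_linearFunctional_zero {n : ℕ} (f : (Fin n → ℝ) →ₗ[ℝ] ℝ) (hf : f ≠ 0) :
    volume {x | f x = 0} = 0 := by
  have := Measure.addHaar_submodule (volume : Measure (Fin n → ℝ)) (LinearMap.ker f)
    (by rwa [Ne, LinearMap.ker_eq_top])
  exact this

lemma ae_abs_injective (n : ℕ) :
    ∀ᵐ x : Fin n → ℝ, (∀ i, x i ≠ 0) ∧ Function.Injective fun i => |x i| := by
  have h0 : ∀ᵐ x : Fin n → ℝ, ∀ i, x i ≠ 0 := by
    refine ae_all_iff.2 fun i => ?_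
    have := volume_linearFunctional_zero (LinearMap.proj i : (Fin n → ℝ) →ₗ[ℝ] ℝ) (by
      intro h
      have := LinearMap.congr_fun h (Pi.single i 1)
      simp at this)
    simpa [ae_iff] using this
  have h1 : ∀ s : ℝ, ∀ᵐ x : Fin n → ℝ, ∀ i j, i ≠ j → x i + s * x j ≠ 0 := by
    intro s
    refine ae_all_iff.2 fun i => ae_all_iff.2 fun j => ?_
    by_cases hij : i = j
    · simp [hij]
    have := volume_linearFunctional_zero
      (LinearMap.proj i + s • LinearMap.proj j : (Fin n → ℝ) →ₗ[ℝ] ℝ) (by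
      intro h
      have := LinearMap.congr_fun h (Pi.single i 1)
      simp [Ne.symm hij] at this)
    simpa [ae_iff, hij] using this
  filter_upwards [h0, h1 1, h1 (-1)] with x hx0 hx1 hx2
  refine ⟨hx0, fun i j hij => ?_⟩
  by_contra hne
  rcases abs_eq_abs.1 hij with h | h
  · exact hx2 i j hne (by rw [h]; ring)
  · exact hx1 i j hne (by rw [h]; ring)

lemma signedPerm_unique {n : ℕ} {g h : Equiv.Perm (Fin n) × (Fin n → ℤˣ)} {x : Fin n → ℝ}
    (hx : (∀ i, x i ≠ 0) ∧ Function.Injective fun i => |x i|)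
    (hg : signedPerm g x ∈ orderCone n) (hh : signedPerm h x ∈ orderCone n) : g = h := by
  obtain ⟨hx0, hinj⟩ := hx
  have key : ∀ g : Equiv.Perm (Fin n) × (Fin n → ℤˣ), signedPerm g x ∈ orderCone n →
      Monotone ((fun i => -|x i|) ∘ g.1) := by
    intro g hg i j hij
    have := hg.2 hij
    rw [signedPerm_eq_abs hg, signedPerm_eq_abs hg] at this
    simpa using this
  have h1 := Tuple.unique_monotone (key g hg) (key h hh)
  have h2 : g.1 = h.1 := by
    ext i
    have := congrFun h1 i
    simp only [Function.comp, neg_inj] at this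
    exact congrArg _ (hinj this)
  refine Prod.ext h2 (funext fun i => ?_)
  have e1 := signedPerm_eq_abs hg i
  have e2 := signedPerm_eq_abs hh i
  rw [← h2, ← e1] at e2
  simp only [signedPerm, ← h2] at e2
  have e3 := mul_right_cancel₀ (hx0 _) e2
  exact (Units.ext (by exact_mod_cast e3)).symm

lemma exists_signedPerm {n : ℕ} (x : Fin n → ℝ) :
    ∃ g : Equiv.Perm (Fin n) × (Fin n → ℤˣ), signedPerm g x ∈ orderCone n := by
  set σ := Tuple.sort (fun j => -|x j|) with hσ
  refine ⟨(σ, fun i => if 0 ≤ x (σ i) then 1 else -1), ?_⟩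
  have habs : ∀ i, signedPerm (σ, fun i => if 0 ≤ x (σ i) then (1 : ℤˣ) else -1) x i
      = |x (σ i)| := by
    intro i
    by_cases h : 0 ≤ x (σ i)
    · simp [signedPerm, h, abs_of_nonneg h]
    · simp [signedPerm, h, abs_of_neg (not_le.1 h)]
  refine ⟨fun i => by rw [habs]; positivity, fun i j hij => ?_⟩
  rw [habs, habs]
  have := Tuple.monotone_sort (fun j => -|x j|) hij
  simpa [← hσ] using this

lemma isClosed_orderCone (n : ℕ) : IsClosed (orderCone n) := by
  have : orderCone n = (⋂ i, {x | 0 ≤ x i}) ∩ ⋂ i, ⋂ j, ⋂ (_ : i ≤ j), {x | x j ≤ x i} := by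
    ext x; simp [orderCone, Antitone]
  rw [this]
  refine (isClosed_iInter fun i => isClosed_le continuous_const (continuous_apply i)).inter ?_
  exact isClosed_iInter fun i => isClosed_iInter fun j => isClosed_iInter fun _ =>
    isClosed_le (continuous_apply j) (continuous_apply i)

lemma eq_iUnion_signedPerm {n : ℕ} {S S₀ : Set (Fin n → ℝ)}
    (hS : ∀ g x, signedPerm g x ∈ orderCone n → (x ∈ S ↔ signedPerm g x ∈ S₀)) :
    S = ⋃ g, signedPerm g ⁻¹' (orderCone n ∩ S₀) := by
  ext x
  simp only [Set.mem_iUnion, Set.mem_preimage, Set.mem_inter_iff]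
  constructor
  · intro hx
    obtain ⟨g, hg⟩ := exists_signedPerm x
    exact ⟨g, hg, (hS g x hg).1 hx⟩
  · rintro ⟨g, hg, h⟩
    exact (hS g x hg).2 h

lemma volume_eq_of_signedPerm {n : ℕ} {S S₀ : Set (Fin n → ℝ)} (hS₀ : MeasurableSet S₀)
    (hS : ∀ g x, signedPerm g x ∈ orderCone n → (x ∈ S ↔ signedPerm g x ∈ S₀)) :
    volume S = (n.factorial * 2 ^ n : ℕ) * volume (orderCone n ∩ S₀) := by
  have hm := (isClosed_orderCone n).measurableSet.inter hS₀
  rw [eq_iUnion_signedPerm hS, measure_iUnion₀]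
  · simp only [(measurePreserving_signedPerm _).measure_preimage hm.nullMeasurableSet]
    rw [tsum_fintype]
    simp [Finset.card_univ, Fintype.card_perm]
  · intro g h hgh
    refine measure_mono_null ?_ (ae_iff.1 (ae_abs_injective n))
    rintro x ⟨h1, h2⟩ hx
    exact hgh (signedPerm_unique hx h1.1 h2.1)
  · exact fun g => ((measurePreserving_signedPerm g).measurable hm).nullMeasurableSet

def tailMap (W : ℕ → ℝ) (n : ℕ) : (Fin n → ℝ) →ₗ[ℝ] (Fin n → ℝ) :=
  Matrix.toLin' (Matrix.of fun i j : Fin n => if i ≤ j then (W j)⁻¹ else 0)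

lemma tailMap_apply (W : ℕ → ℝ) {n : ℕ} (y : Fin n → ℝ) (i : Fin n) :
    tailMap W n y i = ∑ j : Fin n, (if i ≤ j then (W j)⁻¹ else 0) * y j := by
  simp [tailMap, Matrix.mulVec, dotProduct]

lemma tailMap_apply_Ici (W : ℕ → ℝ) {n : ℕ} (y : Fin n → ℝ) (i : Fin n) :
    tailMap W n y i = ∑ j ∈ Finset.Ici i, (W j)⁻¹ * y j := by
  rw [tailMap_apply, ← Finset.sum_filter_add_sum_filter_not _ (fun j => i ≤ j)]
  rw [Finset.sum_eq_zero (s := Finset.univ.filter fun j => ¬ i ≤ j), add_zero]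
  · refine Finset.sum_congr (by ext; simp) fun j hj => ?_
    simp only [Finset.mem_Ici] at hj
    simp [hj]
  · intro j hj
    simp only [Finset.mem_filter] at hj
    simp [hj.2]

lemma det_tailMap (W : ℕ → ℝ) (n : ℕ) :
    LinearMap.det (tailMap W n) = ∏ j : Fin n, (W j)⁻¹ := by
  rw [tailMap, LinearMap.det_toLin', Matrix.det_of_isUpperTriangular]
  · simp
  · intro i j hij
    simp only [id] at hij
    simp [not_le.2 hij]

lemma volume_eq_tailMap_preimage {W : ℕ → ℝ} (hW : ∀ j, 0 < W j) {n : ℕ} (S : Set (Fin n → ℝ)) :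
    volume S = ENNReal.ofReal (∏ j : Fin n, (W j)⁻¹) * volume (tailMap W n ⁻¹' S) := by
  have hpos : 0 < ∏ j : Fin n, (W j)⁻¹ := Finset.prod_pos fun j _ => inv_pos.2 (hW j)
  rw [Measure.addHaar_preimage_linearMap _ (by rw [det_tailMap]; exact hpos.ne'), det_tailMap,
    ← mul_assoc, ← ENNReal.ofReal_mul hpos.le, abs_of_pos (inv_pos.2 hpos), mul_inv_cancel₀ hpos.ne']
  simp

lemma tailMap_mem_orderCone {W : ℕ → ℝ} (hW : ∀ j, 0 < W j) {n : ℕ} (y : Fin n → ℝ) :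
    tailMap W n y ∈ orderCone n ↔ ∀ i, 0 ≤ y i := by
  constructor
  · rintro ⟨h0, hanti⟩ i
    have hsplit : tailMap W n y i = (W i)⁻¹ * y i + ∑ j ∈ Finset.Ioi i, (W j)⁻¹ * y j := by
      rw [tailMap_apply_Ici, ← Finset.Ioi_insert, Finset.sum_insert (by simp)]
    have hle : ∑ j ∈ Finset.Ioi i, (W j)⁻¹ * y j ≤ tailMap W n y i := by
      by_cases hi : (i : ℕ) + 1 < n
      · have : Finset.Ioi i = Finset.Ici (⟨i + 1, hi⟩ : Fin n) := by
          ext j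
          simp only [Finset.mem_Ioi, Finset.mem_Ici, Fin.lt_def, Fin.le_def]
          omega
        rw [this, ← tailMap_apply_Ici]
        exact hanti (by simp [Fin.le_def])
      · have : Finset.Ioi i = ∅ := by
          ext j
          simp only [Finset.mem_Ioi, Fin.lt_def, Finset.notMem_empty, iff_false]
          omega
        rw [this, Finset.sum_empty]
        exact h0 i
    have : 0 ≤ (W i)⁻¹ * y i := by linarith
    exact nonneg_of_mul_nonneg_right this (inv_pos.2 (hW i))
  · intro hy
    have hterm : ∀ j : Fin n, 0 ≤ (W j)⁻¹ * y j := fun j =>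
      mul_nonneg (inv_pos.2 (hW j)).le (hy j)
    refine ⟨fun i => ?_, fun i j hij => ?_⟩
    · rw [tailMap_apply_Ici]
      exact Finset.sum_nonneg fun j _ => hterm j
    · rw [tailMap_apply_Ici, tailMap_apply_Ici]
      exact Finset.sum_le_sum_of_subset_of_nonneg (Finset.Ici_subset_Ici.2 hij)
        fun j _ _ => hterm j

lemma sum_weight_mul_tailMap {w W : ℕ → ℝ} (hW : ∀ j, 0 < W j)
    (hwW : ∀ j, W j = ∑ i ∈ Finset.range (j + 1), w i) {n : ℕ} (y : Fin n → ℝ) :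
    ∑ i : Fin n, w i * tailMap W n y i = ∑ j, y j := by
  simp_rw [tailMap_apply, Finset.mul_sum]
  rw [Finset.sum_comm]
  refine Finset.sum_congr rfl fun j _ => ?_
  have h1 : ∑ i : Fin n, (if i ≤ j then w i else 0) = W j := by
    have := Fin.sum_univ_eq_sum_range (fun i => if i ≤ (j : ℕ) then w i else 0) n
    simp only [Fin.le_def]
    rw [this, hwW, ← Finset.sum_filter]
    refine Finset.sum_congr ?_ fun _ _ => rfl
    ext i
    simp only [Finset.mem_filter, Finset.mem_range]
    omega
  calc ∑ i : Fin n, w i * ((if i ≤ j then (W j)⁻¹ else 0) * y j)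
      = ∑ i : Fin n, (if i ≤ j then w i else 0) * ((W j)⁻¹ * y j) := by
        refine Finset.sum_congr rfl fun i _ => ?_
        split_ifs <;> ring
    _ = y j := by
        rw [← Finset.sum_mul, h1, ← mul_assoc, mul_inv_cancel₀ (hW j).ne', one_mul]

lemma volume_eq_of_signedPerm_tailMap {W : ℕ → ℝ} (hW : ∀ j, 0 < W j) {n : ℕ}
    {S S₀ : Set (Fin n → ℝ)} (hS₀ : MeasurableSet S₀)
    (hS : ∀ g x, signedPerm g x ∈ orderCone n → (x ∈ S ↔ signedPerm g x ∈ S₀)) :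
    volume S = (n.factorial * 2 ^ n : ℕ) * (ENNReal.ofReal (∏ j : Fin n, (W j)⁻¹) *
      volume {y : Fin n → ℝ | (∀ i, 0 ≤ y i) ∧ tailMap W n y ∈ S₀}) := by
  rw [volume_eq_of_signedPerm hS₀ hS, volume_eq_tailMap_preimage hW]
  congr 3
  ext y
  simp [tailMap_mem_orderCone hW]

def cornerSimplex (n : ℕ) : Set (Fin n → ℝ) := {y | (∀ i, 0 ≤ y i) ∧ ∑ i, y i ≤ 1}

lemma sum_abs_signedPerm {n : ℕ} (g : Equiv.Perm (Fin n) × (Fin n → ℤˣ)) (f : ℝ → ℝ)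
    (x : Fin n → ℝ) : ∑ i, f |signedPerm g x i| = ∑ i, f |x i| := by
  simp_rw [abs_signedPerm]
  exact Equiv.sum_comp g.1 fun i => f |x i|

lemma volume_cornerSimplex {n : ℕ} (hn : n ≠ 0) :
    volume (cornerSimplex n) = ENNReal.ofReal ((n.factorial : ℝ)⁻¹) := by
  have : Nonempty (Fin n) := ⟨⟨0, Nat.pos_of_ne_zero hn⟩⟩
  have h1 := volume_sum_rpow_le (Fin n) (le_refl (1 : ℝ)) 1
  have h2 := volume_eq_of_signedPerm_tailMap (W := fun j => (j : ℝ) + 1) (fun j => by positivity)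
    (S := {x : Fin n → ℝ | (∑ i, |x i| ^ (1 : ℝ)) ^ (1 / 1 : ℝ) ≤ 1})
    (S₀ := {x : Fin n → ℝ | ∑ i, x i ≤ 1})
    (measurableSet_le (by fun_prop) measurable_const) (by
      intro g x hg
      simp only [Real.rpow_one, div_one, Set.mem_ofPred_eq]
      rw [← sum_abs_signedPerm g (fun a => a) x]
      simp only [abs_of_nonneg (hg.1 _)])
  have h3 : {y : Fin n → ℝ | (∀ i, 0 ≤ y i) ∧ tailMap (fun j => (j : ℝ) + 1) n y ∈
      {x : Fin n → ℝ | ∑ i, x i ≤ 1}} = cornerSimplex n := by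
    ext y
    have := sum_weight_mul_tailMap (w := fun _ => 1) (W := fun j => (j : ℝ) + 1)
      (fun j => by positivity) (by simp) y
    simp only [one_mul] at this
    simp [cornerSimplex, this]
  have h4 : ∏ j : Fin n, ((j : ℝ) + 1)⁻¹ = (n.factorial : ℝ)⁻¹ := by
    rw [Finset.prod_inv_distrib, Fin.prod_univ_eq_prod_range (fun j => (j : ℝ) + 1)]
    rw [← Finset.prod_range_add_one_eq_factorial]
    push_cast
    rfl
  rw [h1, h3, h4] at h2
  have hf : (0 : ℝ) < n.factorial := by positivity
  simp only [ENNReal.ofReal_one, one_pow, one_mul, div_one, Fintype.card_fin,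
    Real.Gamma_nat_eq_factorial, one_add_one_eq_two, Real.Gamma_two, mul_one] at h2
  have h5 : ((n.factorial * 2 ^ n : ℕ) : ℝ≥0∞) = ENNReal.ofReal (n.factorial * 2 ^ n) := by
    rw [← ENNReal.ofReal_natCast]; push_cast; rfl
  rw [h5, ← mul_assoc, ← ENNReal.ofReal_mul (by positivity)] at h2
  rw [show (n.factorial * 2 ^ n * (n.factorial : ℝ)⁻¹) = 2 ^ n by field_simp] at h2
  rw [div_eq_mul_inv, ENNReal.ofReal_mul (by positivity)] at h2
  refine ((ENNReal.mul_right_inj ?_ ENNReal.ofReal_ne_top).1 h2).symm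
  simp

def lorentzWeightSum (q : ℝ) (j : ℕ) : ℝ :=
  ∑ i ∈ Finset.range (j + 1), ((i : ℝ) + 1) ^ (1 / q - 1)

lemma lorentzWeightSum_pos (q : ℝ) (j : ℕ) : 0 < lorentzWeightSum q j :=
  Finset.sum_pos (fun i _ => by positivity) ⟨0, by simp⟩

lemma sortedAbs_eq_signedPerm {n : ℕ} {g : Equiv.Perm (Fin n) × (Fin n → ℤˣ)} {x : Fin n → ℝ}
    (h : signedPerm g x ∈ orderCone n) (i : Fin n) : sortedAbs x i = signedPerm g x i := by
  rw [signedPerm_eq_abs h, sortedAbs]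
  have h1 : Monotone ((fun j => |x j|) ∘ (Fin.revPerm.trans g.1)) := by
    intro i j hij
    have := h.2 (Fin.rev_le_rev.2 hij)
    rw [signedPerm_eq_abs h, signedPerm_eq_abs h] at this
    simpa using this
  have h2 := congrFun (Tuple.unique_monotone (Tuple.monotone_sort fun j => |x j|) h1) i.rev
  simpa using h2

lemma mem_lorentzBall_iff_signedPerm (q : ℝ) {n : ℕ} {g : Equiv.Perm (Fin n) × (Fin n → ℤˣ)}
    {x : Fin n → ℝ} (h : signedPerm g x ∈ orderCone n) : x ∈ lorentzBall q n ↔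
      signedPerm g x ∈ {x : Fin n → ℝ | ∑ i : Fin n, ((i : ℝ) + 1) ^ (1 / q - 1) * x i ≤ 1} := by
  simp [lorentzBall, lorentzNorm, sortedAbs_eq_signedPerm h]

lemma measurableSet_weighted (q : ℝ) (n : ℕ) :
    MeasurableSet {x : Fin n → ℝ | ∑ i : Fin n, ((i : ℝ) + 1) ^ (1 / q - 1) * x i ≤ 1} :=
  measurableSet_le (by fun_prop) measurable_const

lemma sum_lorentzWeight_mul_tailMap (q : ℝ) {n : ℕ} (y : Fin n → ℝ) :
    ∑ i : Fin n, ((i : ℝ) + 1) ^ (1 / q - 1) * tailMap (lorentzWeightSum q) n y i = ∑ j, y j :=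
  sum_weight_mul_tailMap (w := fun i => ((i : ℝ) + 1) ^ (1 / q - 1)) (lorentzWeightSum_pos q)
    (fun _ => rfl) y

lemma volume_lorentzBall_inter (q : ℝ) {n : ℕ} {A : Set (Fin n → ℝ)} (hA : MeasurableSet A)
    (hinv : ∀ g x, x ∈ A ↔ signedPerm g x ∈ A) :
    volume (lorentzBall q n ∩ A) = (n.factorial * 2 ^ n : ℕ) *
      (ENNReal.ofReal (∏ j : Fin n, (lorentzWeightSum q j)⁻¹) *
      volume (cornerSimplex n ∩ tailMap (lorentzWeightSum q) n ⁻¹' A)) := by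
  rw [volume_eq_of_signedPerm_tailMap (S := lorentzBall q n ∩ A) (lorentzWeightSum_pos q)
    ((measurableSet_weighted q n).inter hA)
    fun g x hg => and_congr (mem_lorentzBall_iff_signedPerm q hg) (hinv g x)]
  congr 3
  ext y
  have h := sum_lorentzWeight_mul_tailMap q y
  rw [one_div] at h
  simp [h, cornerSimplex, and_assoc]

lemma volume_lorentzBall (q : ℝ) {n : ℕ} (hn : n ≠ 0) :
    volume (lorentzBall q n) =
      ENNReal.ofReal (2 ^ n * ∏ j : Fin n, (lorentzWeightSum q j)⁻¹) := by
  have h := volume_lorentzBall_inter q (n := n) MeasurableSet.univ (by simp)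
  have hpos : 0 < ∏ j : Fin n, (lorentzWeightSum q j)⁻¹ :=
    Finset.prod_pos fun j _ => inv_pos.2 (lorentzWeightSum_pos q j)
  rw [Set.inter_univ, Set.preimage_univ, Set.inter_univ, volume_cornerSimplex hn,
    ← ENNReal.ofReal_natCast, ← ENNReal.ofReal_mul hpos.le, ← ENNReal.ofReal_mul (by positivity)] at h
  rw [h]
  congr 1
  have : (n.factorial : ℝ) ≠ 0 := by positivity
  push_cast
  field_simp

lemma volume_lorentzBall_inter_toReal (q : ℝ) {n : ℕ} (hn : n ≠ 0) {A : Set (Fin n → ℝ)}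
    (hA : MeasurableSet A) (hinv : ∀ g x, x ∈ A ↔ signedPerm g x ∈ A) :
    (volume (lorentzBall q n ∩ A)).toReal = (volume (lorentzBall q n)).toReal *
      (n.factorial * (volume (cornerSimplex n ∩ tailMap (lorentzWeightSum q) n ⁻¹' A)).toReal) := by
  have hpos : 0 < ∏ j : Fin n, (lorentzWeightSum q j)⁻¹ :=
    Finset.prod_pos fun j _ => inv_pos.2 (lorentzWeightSum_pos q j)
  rw [volume_lorentzBall_inter q hA hinv, volume_lorentzBall q hn,
    ENNReal.toReal_ofReal (by positivity), ENNReal.toReal_mul, ENNReal.toReal_mul,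
    ENNReal.toReal_ofReal hpos.le]
  simp only [ENNReal.toReal_natCast]
  push_cast
  ring

lemma volume_lorentzBall_toReal (q : ℝ) {n : ℕ} (hn : n ≠ 0) :
    (volume (lorentzBall q n)).toReal = 2 ^ n * ∏ j : Fin n, (lorentzWeightSum q j)⁻¹ := by
  have hpos : 0 < ∏ j : Fin n, (lorentzWeightSum q j)⁻¹ :=
    Finset.prod_pos fun j _ => inv_pos.2 (lorentzWeightSum_pos q j)
  rw [volume_lorentzBall q hn, ENNReal.toReal_ofReal (by positivity)]

lemma volume_lorentzBall_toReal_pos (q : ℝ) {n : ℕ} (hn : n ≠ 0) :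
    0 < (volume (lorentzBall q n)).toReal := by
  have hpos : 0 < ∏ j : Fin n, (lorentzWeightSum q j)⁻¹ :=
    Finset.prod_pos fun j _ => inv_pos.2 (lorentzWeightSum_pos q j)
  rw [volume_lorentzBall_toReal q hn]
  positivity

lemma volume_ellrBall_toReal {r : ℝ} (hr : 1 < r) {n : ℕ} (hn : n ≠ 0) :
    (volume (ellrBall r n)).toReal =
      (2 * Real.Gamma (1 / r + 1)) ^ n / Real.Gamma (n / r + 1) := by
  have : Nonempty (Fin n) := ⟨⟨0, Nat.pos_of_ne_zero hn⟩⟩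
  have h := volume_sum_rpow_le (Fin n) hr.le 1
  have hset : {x : Fin n → ℝ | (∑ i, |x i| ^ r) ^ (1 / r) ≤ 1} = ellrBall r n := by
    ext x
    have h0 : 0 ≤ ∑ i, |x i| ^ r := Finset.sum_nonneg fun i _ => by positivity
    simp only [Set.mem_ofPred_eq, ellrBall]
    rw [one_div, Real.rpow_inv_le_iff_of_pos h0 zero_le_one (by positivity), Real.one_rpow]
  rw [hset] at h
  have h1 : 0 < Real.Gamma (1 / r + 1) := Real.Gamma_pos_of_pos (by positivity)
  have h2 : 0 < Real.Gamma (n / r + 1) := Real.Gamma_pos_of_pos (by positivity)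
  rw [h]
  simp only [ENNReal.ofReal_one, one_pow, one_mul, Fintype.card_fin]
  rw [ENNReal.toReal_ofReal (by positivity)]

lemma volume_ellrBall_toReal_pos {r : ℝ} (hr : 1 < r) {n : ℕ} (hn : n ≠ 0) :
    0 < (volume (ellrBall r n)).toReal := by
  have h1 : 0 < Real.Gamma (1 / r + 1) := Real.Gamma_pos_of_pos (by positivity)
  have h2 : 0 < Real.Gamma (n / r + 1) := Real.Gamma_pos_of_pos (by positivity)
  rw [volume_ellrBall_toReal hr hn]
  positivity

/-- The radius `ρ` for which the intersection of the normalized bodies is a dilate of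
`lorentzBall q n ∩ {∑ |x i| ^ r ≤ ρ}`. -/
def intersectionRadius (q r t : ℝ) (n : ℕ) : ℝ :=
  (t * (volume (ellrBall r n)).toReal ^ (-(1 : ℝ) / n) /
    (volume (lorentzBall q n)).toReal ^ (-(1 : ℝ) / n)) ^ r

open scoped Pointwise in
lemma smul_inter_smul {n : ℕ} {r a b : ℝ} (ha : 0 < a) (hb : 0 < b)
    (B : Set (Fin n → ℝ)) :
    ((fun x : Fin n → ℝ => a • x) '' B) ∩ ((fun x : Fin n → ℝ => b • x) '' ellrBall r n) =
      a • (B ∩ {x | ∑ i, |x i| ^ r ≤ (b / a) ^ r}) := by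
  have key : ∀ z : Fin n → ℝ, ∑ i, |b⁻¹ * (a * z i)| ^ r = (∑ i, |z i| ^ r) / (b / a) ^ r := by
    intro z
    rw [Finset.sum_div]
    refine Finset.sum_congr rfl fun i _ => ?_
    rw [← Real.div_rpow (abs_nonneg _) (by positivity)]
    congr 1
    rw [abs_mul, abs_mul, abs_of_pos ha, abs_of_pos (inv_pos.2 hb)]
    field_simp
  ext x
  simp only [Set.mem_inter_iff, Set.mem_image, Set.mem_smul_set, ellrBall, Set.mem_ofPred_eq]
  constructor
  · rintro ⟨⟨z, hz, rfl⟩, u, hu, hzu⟩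
    refine ⟨z, ⟨hz, ?_⟩, rfl⟩
    have hu' : u = fun i => b⁻¹ * (a * z i) := by
      ext i
      have := congrFun hzu i
      simp only [Pi.smul_apply, smul_eq_mul] at this
      rw [← this]
      field_simp
    rw [hu', key, div_le_one (by positivity)] at hu
    exact hu
  · rintro ⟨z, ⟨hz, hz'⟩, rfl⟩
    refine ⟨⟨z, hz, rfl⟩, fun i => b⁻¹ * (a * z i), ?_, ?_⟩
    · rw [key, div_le_one (by positivity)]
      exact hz'
    · ext i
      simp only [Pi.smul_apply, smul_eq_mul]
      field_simp

lemma measurableSet_sum_rpow_le (n : ℕ) (r ρ : ℝ) :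
    MeasurableSet {x : Fin n → ℝ | ∑ i, |x i| ^ r ≤ ρ} :=
  measurableSet_le (by fun_prop) measurable_const

lemma volume_inter_toReal (q : ℝ) {r t : ℝ} (hr : 1 < r) (ht : 0 < t) {n : ℕ} (hn : n ≠ 0) :
    (volume (volNormLorentzBall q n ∩ (fun x => t • x) '' volNormEllrBall r n)).toReal =
      n.factorial * (volume (cornerSimplex n ∩ {y | ∑ i, |tailMap (lorentzWeightSum q) n y i| ^ r
        ≤ intersectionRadius q r t n})).toReal := by
  have hB := volume_lorentzBall_toReal_pos q hn
  have hE := volume_ellrBall_toReal_pos hr hn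
  have h1 : (fun x => t • x) '' volNormEllrBall r n =
      (fun x : Fin n → ℝ => (t * (volume (ellrBall r n)).toReal ^ (-(1 : ℝ) / n)) • x) ''
        ellrBall r n := by
    rw [volNormEllrBall, Set.image_image]
    simp only [smul_smul]
  have ha : 0 < (volume (lorentzBall q n)).toReal ^ (-(1 : ℝ) / n) := by positivity
  rw [h1, volNormLorentzBall, smul_inter_smul ha (by positivity), Measure.addHaar_smul,
    ENNReal.toReal_mul, volume_lorentzBall_inter_toReal q hn (measurableSet_sum_rpow_le n r _)
      fun g x => by simp only [Set.mem_ofPred_eq]; rw [sum_abs_signedPerm g (fun a => a ^ r)],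
    ← mul_assoc, Module.finrank_fin_fun, abs_of_pos (by positivity),
    ENNReal.toReal_ofReal (by positivity), ← Real.rpow_natCast, ← Real.rpow_mul hB.le,
    div_mul_cancel₀ _ (by exact_mod_cast hn), Real.rpow_neg_one, inv_mul_cancel₀ hB.ne', one_mul]
  rfl

lemma one_le_one_sub_mul_exp {x : ℝ} (hx : |x| ≤ 1 / 2) : 1 ≤ (1 - x) * Real.exp (x + x ^ 2) := by
  obtain ⟨h1, h2⟩ := abs_le.1 hx
  rcases le_or_gt 0 x with h | h
  · have := Real.quadratic_le_exp_of_nonneg (x := x + x ^ 2) (by positivity)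
    have h3 : (1 - x) * (1 + (x + x ^ 2) + (x + x ^ 2) ^ 2 / 2) ≤
        (1 - x) * Real.exp (x + x ^ 2) := mul_le_mul_of_nonneg_left this (by linarith)
    refine le_trans ?_ h3
    have h4 : 0 ≤ x ^ 2 * (1 - x - x ^ 2 - x ^ 3) := by
      refine mul_nonneg (sq_nonneg _) ?_
      nlinarith [mul_nonneg h h, mul_nonneg h (mul_nonneg h h)]
    nlinarith
  · have := Real.add_one_le_exp (x + x ^ 2)
    have h3 : (1 - x) * (x + x ^ 2 + 1) ≤ (1 - x) * Real.exp (x + x ^ 2) :=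
      mul_le_mul_of_nonneg_left this (by linarith)
    refine le_trans ?_ h3
    have : 0 ≤ -x ^ 3 := by
      have := pow_pos (neg_pos.2 h) 3
      nlinarith
    nlinarith

lemma factorial_mul_exp_div_pow_le {n : ℕ} (hn : n ≠ 0) :
    n.factorial * (Real.exp n / (n : ℝ) ^ n) ≤ Real.exp 1 * n := by
  obtain ⟨m, rfl⟩ := Nat.exists_eq_succ_of_ne_zero hn
  have h1 : Stirling.stirlingSeq (m + 1) ≤ Stirling.stirlingSeq 1 :=
    Stirling.stirlingSeq'_antitone (Nat.zero_le m)
  rw [Stirling.stirlingSeq_one, Stirling.stirlingSeq, div_le_iff₀ (by positivity),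
    Real.sqrt_mul (by norm_num)] at h1
  have h2 : (0 : ℝ) < ((m + 1 : ℕ) : ℝ) := by positivity
  have h3 : √((m + 1 : ℕ) : ℝ) ≤ ((m + 1 : ℕ) : ℝ) := by
    rw [Real.sqrt_le_left h2.le]
    have : (1 : ℝ) ≤ ((m + 1 : ℕ) : ℝ) := by simp
    nlinarith
  have h4 : (((m + 1 : ℕ) : ℝ) / Real.exp 1) ^ (m + 1) *
      (Real.exp ((m + 1 : ℕ) : ℝ) / ((m + 1 : ℕ) : ℝ) ^ (m + 1)) = 1 := by
    rw [div_pow, ← Real.exp_nat_mul, mul_one]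
    field_simp
  calc ((m + 1).factorial : ℝ) * (Real.exp ((m + 1 : ℕ) : ℝ) / ((m + 1 : ℕ) : ℝ) ^ (m + 1))
      ≤ (Real.exp 1 / √2 * (√2 * √((m + 1 : ℕ) : ℝ) *
          (((m + 1 : ℕ) : ℝ) / Real.exp 1) ^ (m + 1))) *
        (Real.exp ((m + 1 : ℕ) : ℝ) / ((m + 1 : ℕ) : ℝ) ^ (m + 1)) :=
        mul_le_mul_of_nonneg_right h1 (by positivity)
    _ = Real.exp 1 * √((m + 1 : ℕ) : ℝ) * ((((m + 1 : ℕ) : ℝ) / Real.exp 1) ^ (m + 1) *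
          (Real.exp ((m + 1 : ℕ) : ℝ) / ((m + 1 : ℕ) : ℝ) ^ (m + 1))) := by
        have : √(2 : ℝ) ≠ 0 := by positivity
        field_simp
    _ = Real.exp 1 * √((m + 1 : ℕ) : ℝ) := by rw [h4, mul_one]
    _ ≤ _ := by gcongr

lemma integrable_indicator_exp {c : ℝ} (hc : 0 < c) :
    Integrable ((Set.Ici 0).indicator fun y : ℝ => Real.exp (-c * y)) :=
  (integrable_indicator_iff measurableSet_Ici).2
    ((integrableOn_Ici_iff_integrableOn_Ioi).2 (integrableOn_exp_mul_Ioi (neg_neg_of_pos hc) 0))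

lemma integral_indicator_exp {c : ℝ} (hc : 0 < c) :
    ∫ y, (Set.Ici 0).indicator (fun y : ℝ => Real.exp (-c * y)) y = c⁻¹ := by
  rw [integral_indicator measurableSet_Ici, integral_Ici_eq_integral_Ioi,
    integral_exp_mul_Ioi (neg_neg_of_pos hc)]
  simp

lemma volume_le_prod_inv {n : ℕ} {c : Fin n → ℝ} (hc : ∀ j, 0 < c j) (K : ℝ)
    {S : Set (Fin n → ℝ)} (hS0 : ∀ y ∈ S, ∀ i, 0 ≤ y i) (hS : ∀ y ∈ S, ∑ j, c j * y j ≤ K) :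
    (volume S).toReal ≤ Real.exp K * ∏ j, (c j)⁻¹ := by
  set f : (Fin n → ℝ) → ℝ := fun y =>
    ∏ j, (Set.Ici 0).indicator (fun y : ℝ => Real.exp (-c j * y)) (y j) with hf
  have hfi : Integrable f := Integrable.fintype_prod fun j => integrable_indicator_exp (hc j)
  have hval : ∫ y, f y = ∏ j, (c j)⁻¹ := by
    rw [hf, integral_fintype_prod_volume_eq_prod
      (f := fun j => (Set.Ici 0).indicator (fun y : ℝ => Real.exp (-c j * y)))]
    exact Finset.prod_congr rfl fun j _ => integral_indicator_exp (hc j)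
  have hf0 : ∀ y, 0 ≤ f y := fun y => Finset.prod_nonneg fun j _ =>
    Set.indicator_nonneg (fun _ _ => (Real.exp_pos _).le) _
  have hle : volume S ≤ ENNReal.ofReal (Real.exp K * ∏ j, (c j)⁻¹) := by
    rw [← hval, ← integral_const_mul, ofReal_integral_eq_lintegral_ofReal (hfi.const_mul _)
      (Eventually.of_forall fun y => mul_nonneg (Real.exp_pos K).le (hf0 y))]
    calc volume S = ∫⁻ _ in S, 1 := by simp
      _ ≤ ∫⁻ y in S, ENNReal.ofReal (Real.exp K * f y) := by
        refine setLIntegral_mono_ae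
          (hfi.const_mul _).aestronglyMeasurable.aemeasurable.ennreal_ofReal.restrict
          (Eventually.of_forall fun y hy => ?_)
        have hfy : f y = Real.exp (-∑ j, c j * y j) := by
          rw [hf, ← Finset.sum_neg_distrib, Real.exp_sum]
          refine Finset.prod_congr rfl fun j _ => ?_
          rw [Set.indicator_of_mem (Set.mem_Ici.2 (hS0 y hy j)), neg_mul]
        rw [hfy, ← Real.exp_add, ENNReal.one_le_ofReal, Real.one_le_exp_iff]
        linarith [hS y hy]
      _ ≤ _ := setLIntegral_le_lintegral _ _
  exact ENNReal.toReal_le_of_le_ofReal (mul_nonneg (Real.exp_pos K).le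
    (Finset.prod_nonneg fun j _ => (inv_pos.2 (hc j)).le)) hle

/-- Chernoff bound for a linear functional under the uniform distribution on the simplex. -/
lemma volume_simplex_tail_le {n : ℕ} (hn : n ≠ 0) {a : Fin n → ℝ} {τ : ℝ}
    (hτ : ∀ j, |τ * a j| ≤ 1 / 2) (d : ℝ) :
    n.factorial * (volume (cornerSimplex n ∩
      {y | d ≤ τ * (n * ∑ j, a j * y j - ∑ j, a j)})).toReal ≤
      Real.exp 1 * n * Real.exp (τ ^ 2 * ∑ j, a j ^ 2 - d) := by
  have hn0 : (0 : ℝ) < n := by positivity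
  have h1 : ∀ j, 0 < 1 - τ * a j := fun j => by linarith [(abs_le.1 (hτ j)).2]
  have hc : ∀ j, 0 < n * (1 - τ * a j) := fun j => mul_pos hn0 (h1 j)
  have h := volume_le_prod_inv hc (n - τ * ∑ j, a j - d)
    (S := cornerSimplex n ∩ {y | d ≤ τ * (n * ∑ j, a j * y j - ∑ j, a j)})
    (fun y hy => hy.1.1) (fun y hy => by
      have h2 : d ≤ τ * (n * ∑ j, a j * y j - ∑ j, a j) := hy.2
      have h3 : (n : ℝ) * ∑ j, y j ≤ n * 1 := mul_le_mul_of_nonneg_left hy.1.2 hn0.le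
      have h4 : ∑ j, n * (1 - τ * a j) * y j = n * ∑ j, y j - τ * (n * ∑ j, a j * y j) := by
        simp only [Finset.mul_sum, ← Finset.sum_sub_distrib]
        exact Finset.sum_congr rfl fun j _ => by ring
      rw [h4]
      linarith)
  have h5 : ∏ j, (n * (1 - τ * a j))⁻¹ ≤
      ((n : ℝ) ^ n)⁻¹ * Real.exp (∑ j, (τ * a j + (τ * a j) ^ 2)) := by
    rw [Real.exp_sum]
    calc ∏ j, (n * (1 - τ * a j))⁻¹
        ≤ ∏ j, ((n : ℝ)⁻¹ * Real.exp (τ * a j + (τ * a j) ^ 2)) := by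
          refine Finset.prod_le_prod (fun j _ => (inv_pos.2 (hc j)).le) fun j _ => ?_
          rw [mul_inv]
          refine mul_le_mul_of_nonneg_left ?_ (inv_pos.2 hn0).le
          rw [inv_le_iff_one_le_mul₀' (h1 j)]
          exact one_le_one_sub_mul_exp (hτ j)
      _ = _ := by rw [Finset.prod_mul_distrib]; simp
  have h6 : ∑ j, (τ * a j + (τ * a j) ^ 2) = τ * ∑ j, a j + τ ^ 2 * ∑ j, a j ^ 2 := by
    simp only [Finset.mul_sum, ← Finset.sum_add_distrib]
    exact Finset.sum_congr rfl fun j _ => by ring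
  rw [h6] at h5
  calc (n.factorial : ℝ) * (volume (cornerSimplex n ∩
      {y | d ≤ τ * (n * ∑ j, a j * y j - ∑ j, a j)})).toReal
      ≤ n.factorial * (Real.exp (n - τ * ∑ j, a j - d) *
        (((n : ℝ) ^ n)⁻¹ * Real.exp (τ * ∑ j, a j + τ ^ 2 * ∑ j, a j ^ 2))) :=
        mul_le_mul_of_nonneg_left (h.trans (mul_le_mul_of_nonneg_left h5 (Real.exp_pos _).le))
          (by positivity)
    _ = n.factorial * (Real.exp n / (n : ℝ) ^ n) * Real.exp (τ ^ 2 * ∑ j, a j ^ 2 - d) := by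
        rw [show Real.exp (n - τ * ∑ j, a j - d) * (((n : ℝ) ^ n)⁻¹ *
          Real.exp (τ * ∑ j, a j + τ ^ 2 * ∑ j, a j ^ 2)) = (Real.exp (n - τ * ∑ j, a j - d) *
          Real.exp (τ * ∑ j, a j + τ ^ 2 * ∑ j, a j ^ 2)) * ((n : ℝ) ^ n)⁻¹ by ring,
          ← Real.exp_add, show n - τ * ∑ j, a j - d + (τ * ∑ j, a j + τ ^ 2 * ∑ j, a j ^ 2) =
          n + (τ ^ 2 * ∑ j, a j ^ 2 - d) by ring, Real.exp_add]
        ring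
    _ ≤ _ := mul_le_mul_of_nonneg_right (factorial_mul_exp_div_pow_le hn) (Real.exp_pos _).le

/-- Two-sided deviation bound for a linear functional with coefficients in `[0, 1]` on the
simplex. -/
lemma volume_simplex_deviation_le {n : ℕ} (hn : n ≠ 0) {a : Fin n → ℝ} (ha0 : ∀ j, 0 ≤ a j)
    (ha1 : ∀ j, a j ≤ 1) {τ : ℝ} (hτ0 : 0 < τ) (hτ : τ ≤ 1 / 2) (δ : ℝ) :
    n.factorial * (volume (cornerSimplex n ∩
      {y | δ ≤ |n * ∑ j, a j * y j - ∑ j, a j|})).toReal ≤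
      2 * (Real.exp 1 * n * Real.exp (τ ^ 2 * ∑ j, a j - τ * δ)) := by
  have hfin : ∀ A : Set (Fin n → ℝ), volume (cornerSimplex n ∩ A) ≠ ⊤ := fun A =>
    ne_top_of_le_ne_top (by rw [volume_cornerSimplex hn]; exact ENNReal.ofReal_ne_top)
      (measure_mono Set.inter_subset_left)
  have hbd : ∀ s : ℝ, |s| = τ → ∀ j, |s * a j| ≤ 1 / 2 := by
    intro s hs j
    rw [abs_mul, hs, abs_of_nonneg (ha0 j)]
    nlinarith [ha0 j, ha1 j]
  have hsq : ∑ j, a j ^ 2 ≤ ∑ j, a j :=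
    Finset.sum_le_sum fun j _ => by nlinarith [ha0 j, ha1 j]
  have hexp : Real.exp (τ ^ 2 * ∑ j, a j ^ 2 - τ * δ) ≤
      Real.exp (τ ^ 2 * ∑ j, a j - τ * δ) := by gcongr
  have h1 := volume_simplex_tail_le hn (hbd τ (abs_of_pos hτ0)) (τ * δ)
  have h2 := volume_simplex_tail_le hn (hbd (-τ) (by rw [abs_neg, abs_of_pos hτ0])) (τ * δ)
  rw [neg_sq] at h2
  have hsub : cornerSimplex n ∩ {y | δ ≤ |n * ∑ j, a j * y j - ∑ j, a j|} ⊆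
      (cornerSimplex n ∩ {y | τ * δ ≤ τ * (n * ∑ j, a j * y j - ∑ j, a j)}) ∪
      (cornerSimplex n ∩ {y | τ * δ ≤ -τ * (n * ∑ j, a j * y j - ∑ j, a j)}) := by
    rintro y ⟨hy, hy'⟩
    rcases le_abs.1 (show δ ≤ |n * ∑ j, a j * y j - ∑ j, a j| from hy') with h | h
    · exact Or.inl ⟨hy, mul_le_mul_of_nonneg_left h hτ0.le⟩
    · refine Or.inr ⟨hy, ?_⟩
      have := mul_le_mul_of_nonneg_left h hτ0.le
      simp only [Set.mem_ofPred_eq]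
      linarith
  have h3 := ENNReal.toReal_mono (ENNReal.add_ne_top.2 ⟨hfin _, hfin _⟩)
    ((measure_mono hsub).trans (measure_union_le _ _))
  rw [ENNReal.toReal_add (hfin _) (hfin _)] at h3
  have h4 := mul_le_mul_of_nonneg_left h3 (Nat.cast_nonneg' (α := ℝ) n.factorial)
  have h5 := mul_le_mul_of_nonneg_left hexp (by positivity : 0 ≤ Real.exp 1 * (n : ℝ))
  linarith

lemma rpow_add_le_of_le_one {β x s : ℝ} (hβ0 : 0 ≤ β) (hβ1 : β ≤ 1) (hx : 0 < x) (hs : -x ≤ s) :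
    (x + s) ^ β ≤ x ^ β + β * s * x ^ (β - 1) := by
  have h1 : -1 ≤ s / x := by rw [le_div_iff₀ hx]; linarith
  have h2 := rpow_one_add_le_one_add_mul_self h1 hβ0 hβ1
  have h3 : (x + s) ^ β = x ^ β * (1 + s / x) ^ β := by
    rw [← Real.mul_rpow hx.le (by linarith)]
    congr 1
    field_simp
  rw [h3, Real.rpow_sub_one hx.ne']
  calc x ^ β * (1 + s / x) ^ β ≤ x ^ β * (1 + β * (s / x)) := by gcongr
    _ = _ := by ring

lemma sum_rpow_le {β : ℝ} (hβ0 : 0 < β) (hβ1 : β ≤ 1) (n : ℕ) :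
    ∑ i ∈ Finset.range n, ((i : ℝ) + 1) ^ (β - 1) ≤ (n : ℝ) ^ β / β := by
  induction n with
  | zero => simp [Real.zero_rpow hβ0.ne']
  | succ n ih =>
    have h := rpow_add_le_of_le_one hβ0.le hβ1 (x := (n : ℝ) + 1) (s := -1) (by positivity)
      (by linarith [Nat.cast_nonneg (α := ℝ) n])
    rw [add_neg_cancel_right] at h
    rw [le_div_iff₀ hβ0] at ih ⊢
    rw [Finset.sum_range_succ]
    push_cast
    linarith

lemma le_sum_rpow {β : ℝ} (hβ0 : 0 < β) (hβ1 : β ≤ 1) (n : ℕ) :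
    ((n : ℝ) ^ β - 1) / β ≤ ∑ i ∈ Finset.range n, ((i : ℝ) + 1) ^ (β - 1) := by
  have key : (((n : ℝ) + 1) ^ β - 1) / β ≤ ∑ i ∈ Finset.range n, ((i : ℝ) + 1) ^ (β - 1) := by
    induction n with
    | zero => simp
    | succ n ih =>
      have h := rpow_add_le_of_le_one hβ0.le hβ1 (x := (n : ℝ) + 1) (s := 1) (by positivity)
        (by linarith [Nat.cast_nonneg (α := ℝ) n])
      rw [div_le_iff₀ hβ0] at ih ⊢
      rw [Finset.sum_range_succ]
      push_cast
      linarith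
  refine le_trans ?_ key
  gcongr
  linarith

lemma tendsto_natCast_rpow_atTop {β : ℝ} (hβ : 0 < β) :
    Tendsto (fun n : ℕ => (n : ℝ) ^ β) atTop atTop :=
  (tendsto_rpow_atTop hβ).comp tendsto_natCast_atTop_atTop

lemma tendsto_sum_rpow_div {β : ℝ} (hβ0 : 0 < β) (hβ1 : β ≤ 1) :
    Tendsto (fun n : ℕ => (∑ i ∈ Finset.range n, ((i : ℝ) + 1) ^ (β - 1)) / (n : ℝ) ^ β)
      atTop (nhds β⁻¹) := by
  have h1 : Tendsto (fun n : ℕ => β⁻¹ - β⁻¹ * ((n : ℝ) ^ β)⁻¹) atTop (nhds β⁻¹) := by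
    have := ((tendsto_natCast_rpow_atTop hβ0).inv_tendsto_atTop.const_mul β⁻¹).const_sub β⁻¹
    simpa using this
  refine tendsto_of_tendsto_of_tendsto_of_le_of_le' h1 tendsto_const_nhds ?_ ?_
  · filter_upwards [eventually_gt_atTop 0] with n hn
    have hn' : (0 : ℝ) < (n : ℝ) ^ β := by positivity
    rw [le_div_iff₀ hn']
    refine le_trans (le_of_eq ?_) (le_sum_rpow hβ0 hβ1 n)
    field_simp
  · filter_upwards [eventually_gt_atTop 0] with n hn
    have hn' : (0 : ℝ) < (n : ℝ) ^ β := by positivity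
    rw [div_le_iff₀ hn']
    refine (sum_rpow_le hβ0 hβ1 n).trans (le_of_eq ?_)
    field_simp

lemma tendsto_sum_div_sum {u v : ℕ → ℝ} {L : ℝ} (hv : ∀ n, 0 < v n)
    (hdiv : Tendsto (fun n => ∑ i ∈ Finset.range n, v i) atTop atTop)
    (h : Tendsto (fun n => u n / v n) atTop (nhds L)) :
    Tendsto (fun n => (∑ i ∈ Finset.range n, u i) / ∑ i ∈ Finset.range n, v i)
      atTop (nhds L) := by
  have h1 : (fun n => u n - L * v n) =o[atTop] v := by
    rw [Asymptotics.isLittleO_iff_tendsto fun n hn => absurd hn (hv n).ne']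
    have := h.sub_const L
    rw [sub_self] at this
    refine this.congr fun n => ?_
    have := (hv n).ne'
    field_simp
  have h2 := h1.sum_range (fun n => (hv n).le) hdiv
  have h3 := h2.tendsto_div_nhds_zero.add_const L
  rw [zero_add] at h3
  refine h3.congr' ?_
  filter_upwards [hdiv.eventually_gt_atTop 0] with n hn
  rw [Finset.sum_sub_distrib, ← Finset.mul_sum]
  field_simp
  ring

lemma eventually_forall_le_abs_le {e g : ℕ → ℝ} (hg : Monotone g) (hg0 : ∀ n, 0 ≤ g n)
    (hgt : Tendsto g atTop atTop) (h : e =o[atTop] g) {ε : ℝ} (hε : 0 < ε) :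
    ∀ᶠ n in atTop, ∀ m ≤ n, |e m| ≤ ε * g n := by
  obtain ⟨M, hM⟩ := eventually_atTop.1 (h.def hε)
  have hbig := (hgt.const_mul_atTop hε).eventually_ge_atTop (∑ m ∈ Finset.range M, |e m|)
  filter_upwards [hbig] with n hn m hmn
  rcases lt_or_ge m M with hm | hm
  · exact (Finset.single_le_sum (f := fun m => |e m|) (fun _ _ => abs_nonneg _)
      (Finset.mem_range.2 hm)).trans hn
  · have := hM m hm
    rw [Real.norm_eq_abs, Real.norm_eq_abs, abs_of_nonneg (hg0 m)] at this
    exact this.trans (mul_le_mul_of_nonneg_left (hg hmn) hε.le)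

lemma one_le_lorentzWeightSum (q : ℝ) (j : ℕ) : 1 ≤ lorentzWeightSum q j := by
  have := Finset.single_le_sum (f := fun i : ℕ => ((i : ℝ) + 1) ^ (1 / q - 1))
    (fun i _ => by positivity) (Finset.mem_range.2 (Nat.succ_pos j))
  simpa [lorentzWeightSum] using this

lemma tendsto_lorentzWeightSum_div {q : ℝ} (hq : 1 < q) :
    Tendsto (fun j : ℕ => lorentzWeightSum q j / ((j : ℝ) + 1) ^ (1 / q)) atTop (nhds q) := by
  have h := (tendsto_sum_rpow_div (β := 1 / q) (by positivity)
    (by rw [div_le_one (by positivity)]; exact hq.le)).comp (tendsto_add_atTop_nat 1)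
  rw [one_div, inv_inv, ← one_div] at h
  refine h.congr fun j => ?_
  simp [lorentzWeightSum]

def invWeightSum (q : ℝ) (n : ℕ) : ℝ := ∑ j ∈ Finset.range n, (lorentzWeightSum q j)⁻¹

lemma tendsto_invWeightSum_div {q : ℝ} (hq : 1 < q) :
    Tendsto (fun n : ℕ => invWeightSum q n / (n : ℝ) ^ (1 - 1 / q)) atTop
      (nhds (q - 1)⁻¹) := by
  have hq0 : 0 < q := by linarith
  have hα0 : 0 < 1 - 1 / q := by
    rw [sub_pos, div_lt_one hq0]; exact hq
  have hα1 : 1 - 1 / q ≤ 1 := by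
    have : 0 < 1 / q := by positivity
    linarith
  have h1 := tendsto_sum_rpow_div hα0 hα1
  have hdiv : Tendsto (fun n => ∑ i ∈ Finset.range n, ((i : ℝ) + 1) ^ (1 - 1 / q - 1))
      atTop atTop := by
    refine tendsto_atTop_mono (le_sum_rpow hα0 hα1) ?_
    exact (tendsto_atTop_add_const_right _ (-1) (tendsto_natCast_rpow_atTop hα0)).atTop_div_const
      hα0
  have h2 : Tendsto (fun n : ℕ => (lorentzWeightSum q n)⁻¹ / ((n : ℝ) + 1) ^ (1 - 1 / q - 1))
      atTop (nhds q⁻¹) := by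
    refine ((tendsto_lorentzWeightSum_div hq).inv₀ hq0.ne').congr fun n => ?_
    rw [show 1 - 1 / q - 1 = -(1 / q) by ring, Real.rpow_neg (by positivity)]
    rw [inv_div, div_inv_eq_mul, div_eq_mul_inv, mul_comm]
  have h3 := (tendsto_sum_div_sum (fun n => by positivity) hdiv h2).mul h1
  have h4 : q⁻¹ * (1 - 1 / q)⁻¹ = (q - 1)⁻¹ := by
    rw [← mul_inv, mul_sub, mul_one, mul_one_div_cancel hq0.ne']
  rw [h4] at h3
  refine h3.congr' ?_
  filter_upwards [hdiv.eventually_gt_atTop 0] with n hn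
  rw [invWeightSum, div_mul_div_cancel₀ hn.ne']

lemma eventually_invWeightSum_close {q : ℝ} (hq : 1 < q) {ε : ℝ} (hε : 0 < ε) :
    ∀ᶠ n : ℕ in atTop, ∀ m ≤ n,
      |invWeightSum q m - (q - 1)⁻¹ * (m : ℝ) ^ (1 - 1 / q)| ≤ ε * (n : ℝ) ^ (1 - 1 / q) := by
  have hα0 : 0 < 1 - 1 / q := by
    rw [sub_pos, div_lt_one (by linarith)]; exact hq
  refine eventually_forall_le_abs_le (g := fun n : ℕ => (n : ℝ) ^ (1 - 1 / q))
    (e := fun m => invWeightSum q m - (q - 1)⁻¹ * (m : ℝ) ^ (1 - 1 / q))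
    (fun a b hab => by dsimp only; gcongr) (fun n => by positivity)
    (tendsto_natCast_rpow_atTop hα0) ?_ hε
  refine (Asymptotics.isLittleO_iff_tendsto' ?_).2 ?_
  · filter_upwards [eventually_gt_atTop 0] with n hn h0
    have : (0 : ℝ) < (n : ℝ) ^ (1 - 1 / q) := by positivity
    exact absurd h0 this.ne'
  · have := (tendsto_invWeightSum_div hq).sub_const (q - 1)⁻¹
    rw [sub_self] at this
    refine this.congr' ?_
    filter_upwards [eventually_gt_atTop 0] with n hn
    have : (0 : ℝ) < (n : ℝ) ^ (1 - 1 / q) := by positivity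
    field_simp

lemma tendsto_log_natCast_div : Tendsto (fun n : ℕ => Real.log n / n) atTop (nhds 0) := by
  exact (Real.isLittleO_log_id_atTop.tendsto_div_nhds_zero).comp
    (tendsto_natCast_atTop_atTop (R := ℝ))

lemma tendsto_log_factorial_div_sub_log :
    Tendsto (fun n : ℕ => Real.log n.factorial / n - Real.log n) atTop (nhds (-1)) := by
  have hinv : Tendsto (fun n : ℕ => ((n : ℝ))⁻¹) atTop (nhds 0) :=
    tendsto_inv_atTop_zero.comp tendsto_natCast_atTop_atTop
  have h1 : Tendsto (fun n : ℕ => Real.log (Stirling.stirlingSeq n) * (n : ℝ)⁻¹) atTop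
      (nhds 0) := by
    have h := (Stirling.tendsto_stirlingSeq_sqrt_pi.log (by positivity)).mul hinv
    rwa [mul_zero] at h
  have h2 : Tendsto (fun n : ℕ => Real.log (Stirling.stirlingSeq n) * (n : ℝ)⁻¹ +
      1 / 2 * (Real.log 2 * (n : ℝ)⁻¹ + Real.log n / n) - 1) atTop (nhds (-1)) := by
    have h := (h1.add (((hinv.const_mul (Real.log 2)).add tendsto_log_natCast_div).const_mul
      (1 / 2))).sub_const 1
    simpa using h
  refine h2.congr' ?_
  filter_upwards [eventually_gt_atTop 0] with n hn
  have hn' : (0 : ℝ) < n := by exact_mod_cast hn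
  rw [Stirling.log_stirlingSeq_formula, Real.log_mul (by norm_num) hn'.ne',
    Real.log_div hn'.ne' (Real.exp_pos 1).ne', Real.log_exp]
  field_simp
  ring

lemma log_Gamma_floor_bounds {x : ℝ} (hx : 1 ≤ x) :
    Real.log (⌊x⌋₊.factorial) ≤ Real.log (Real.Gamma (x + 1)) ∧
      Real.log (Real.Gamma (x + 1)) ≤ Real.log (⌊x⌋₊.factorial) + Real.log (x + 1) := by
  have hx0 : 0 ≤ x := by linarith
  have hk : (1 : ℝ) ≤ ⌊x⌋₊ := by exact_mod_cast Nat.le_floor (by simpa using hx)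
  have h1 := Nat.floor_le hx0
  have h2 := Nat.lt_floor_add_one x
  have hmono := Real.Gamma_strictMonoOn_Ici.monotoneOn
  constructor
  · refine Real.log_le_log (by positivity) ?_
    rw [← Real.Gamma_nat_eq_factorial]
    exact hmono (by simp only [Set.mem_Ici]; linarith) (by simp only [Set.mem_Ici]; linarith)
      (by linarith)
  · have h3 : Real.Gamma (x + 1) ≤ (⌊x⌋₊ + 1).factorial := by
      rw [← Real.Gamma_nat_eq_factorial]
      push_cast
      exact hmono (by simp only [Set.mem_Ici]; linarith) (by simp only [Set.mem_Ici]; linarith)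
        (by linarith)
    calc Real.log (Real.Gamma (x + 1)) ≤ Real.log ((⌊x⌋₊ + 1).factorial) :=
          Real.log_le_log (Real.Gamma_pos_of_pos (by linarith)) h3
      _ = Real.log (⌊x⌋₊.factorial) + Real.log (⌊x⌋₊ + 1) := by
          rw [Nat.factorial_succ]
          push_cast
          rw [Real.log_mul (by positivity) (by positivity), add_comm]
      _ ≤ _ := by gcongr

lemma tendsto_log_Gamma_div_sub_log {r : ℝ} (hr : 1 < r) :
    Tendsto (fun n : ℕ => Real.log (Real.Gamma (n / r + 1)) / n - 1 / r * Real.log n) atTop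
      (nhds (-(1 / r) * (1 + Real.log r))) := by
  have hr0 : 0 < r := by linarith
  have hx : Tendsto (fun n : ℕ => (n : ℝ) / r) atTop atTop :=
    tendsto_natCast_atTop_atTop.atTop_div_const hr0
  have hk : Tendsto (fun n : ℕ => ⌊(n : ℝ) / r⌋₊) atTop atTop := tendsto_nat_floor_atTop.comp hx
  have hinv : Tendsto (fun n : ℕ => ((n : ℝ))⁻¹) atTop (nhds 0) :=
    tendsto_inv_atTop_zero.comp tendsto_natCast_atTop_atTop
  have hratio : Tendsto (fun n : ℕ => (⌊(n : ℝ) / r⌋₊ : ℝ) / n) atTop (nhds (1 / r)) := by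
    have h := (tendsto_nat_floor_mul_div_atTop (R := ℝ) (a := 1 / r) (by positivity)).comp
      tendsto_natCast_atTop_atTop
    refine h.congr fun n => ?_
    simp only [Function.comp]
    rw [one_div_mul_eq_div]
  have hlogratio : Tendsto (fun n : ℕ => Real.log ((⌊(n : ℝ) / r⌋₊ : ℝ) / n)) atTop
      (nhds (-Real.log r)) := by
    have := hratio.log (by positivity)
    rwa [one_div, Real.log_inv] at this
  have hsmall : Tendsto (fun n : ℕ => ((⌊(n : ℝ) / r⌋₊ : ℝ) / n - 1 / r) * Real.log n) atTop
      (nhds 0) := by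
    refine squeeze_zero_norm' ?_ tendsto_log_natCast_div
    filter_upwards [eventually_gt_atTop 0] with n hn
    have hn' : (1 : ℝ) ≤ n := by exact_mod_cast hn
    have h1 := Nat.floor_le (a := (n : ℝ) / r) (by positivity)
    have h2 := Nat.lt_floor_add_one ((n : ℝ) / r)
    have h3 : |(⌊(n : ℝ) / r⌋₊ : ℝ) / n - 1 / r| ≤ (n : ℝ)⁻¹ := by
      have : (⌊(n : ℝ) / r⌋₊ : ℝ) / n - 1 / r = ((⌊(n : ℝ) / r⌋₊ : ℝ) - n / r) * (n : ℝ)⁻¹ := by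
        field_simp
      rw [this, abs_mul, abs_of_pos (a := (n : ℝ)⁻¹) (by positivity)]
      refine mul_le_of_le_one_left (by positivity) (abs_le.2 ⟨by linarith, by linarith⟩)
    rw [norm_mul, Real.norm_eq_abs, Real.norm_eq_abs, abs_of_nonneg (Real.log_nonneg hn'),
      div_eq_inv_mul (Real.log n)]
    exact mul_le_mul_of_nonneg_right h3 (Real.log_nonneg hn')
  have hlow : Tendsto (fun n : ℕ => Real.log (⌊(n : ℝ) / r⌋₊.factorial) / n -
      1 / r * Real.log n) atTop (nhds (-(1 / r) * (1 + Real.log r))) := by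
    have h := ((hratio.mul (tendsto_log_factorial_div_sub_log.comp hk)).add
      (hratio.mul hlogratio)).add hsmall
    have e : 1 / r * -1 + 1 / r * -Real.log r + 0 = -(1 / r) * (1 + Real.log r) := by ring
    rw [e] at h
    refine h.congr' ?_
    filter_upwards [hk.eventually_gt_atTop 0, eventually_gt_atTop 0] with n hkn hn
    have hn' : (0 : ℝ) < n := by exact_mod_cast hn
    have hk' : (0 : ℝ) < ⌊(n : ℝ) / r⌋₊ := by exact_mod_cast hkn
    simp only [Function.comp]
    rw [Real.log_div hk'.ne' hn'.ne']
    field_simp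
    ring
  have hhigh : Tendsto (fun n : ℕ => Real.log (⌊(n : ℝ) / r⌋₊.factorial) / n -
      1 / r * Real.log n + (Real.log 2 * (n : ℝ)⁻¹ + Real.log n / n)) atTop
      (nhds (-(1 / r) * (1 + Real.log r))) := by
    have h := hlow.add ((hinv.const_mul (Real.log 2)).add tendsto_log_natCast_div)
    simpa using h
  refine tendsto_of_tendsto_of_tendsto_of_le_of_le' hlow hhigh ?_ ?_
  · filter_upwards [hx.eventually_ge_atTop 1] with n hn
    have := (log_Gamma_floor_bounds hn).1
    gcongr
  · filter_upwards [hx.eventually_ge_atTop 1, eventually_gt_atTop 0] with n hn hn0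
    have hn' : (1 : ℝ) ≤ n := by exact_mod_cast hn0
    have h1 := (log_Gamma_floor_bounds hn).2
    have h2 : Real.log ((n : ℝ) / r + 1) ≤ Real.log 2 + Real.log n := by
      rw [← Real.log_mul (by norm_num) (by linarith)]
      refine Real.log_le_log (by positivity) ?_
      have : (n : ℝ) / r ≤ n := div_le_self (by linarith) hr.le
      linarith
    have h3 : Real.log (Real.Gamma (n / r + 1)) / n ≤
        (Real.log (⌊(n : ℝ) / r⌋₊.factorial) + (Real.log 2 + Real.log n)) / n := by
      gcongr
      linarith
    refine (sub_le_sub_right h3 _).trans (le_of_eq ?_)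
    field_simp
    ring

lemma tendsto_log_prod_lorentzWeightSum {q : ℝ} (hq : 1 < q) :
    Tendsto (fun n : ℕ => (∑ j ∈ Finset.range n, Real.log (lorentzWeightSum q j)) / n -
      1 / q * Real.log n) atTop (nhds (Real.log q - 1 / q)) := by
  have hq0 : 0 < q := by linarith
  have h1 := ((tendsto_lorentzWeightSum_div hq).log hq0.ne').cesaro
  have h2 := h1.add (tendsto_log_factorial_div_sub_log.const_mul (1 / q))
  have e : Real.log q + 1 / q * -1 = Real.log q - 1 / q := by ring
  rw [e] at h2
  refine h2.congr' ?_
  filter_upwards [eventually_gt_atTop 0] with n hn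
  have hn' : (0 : ℝ) < n := by exact_mod_cast hn
  have h3 : ∑ i ∈ Finset.range n, Real.log (lorentzWeightSum q i / ((i : ℝ) + 1) ^ (1 / q)) =
      ∑ i ∈ Finset.range n, Real.log (lorentzWeightSum q i) - 1 / q * Real.log n.factorial := by
    rw [← Finset.prod_range_add_one_eq_factorial]
    push_cast
    rw [Real.log_prod (fun i _ => by positivity), Finset.mul_sum, ← Finset.sum_sub_distrib]
    refine Finset.sum_congr rfl fun i _ => ?_
    rw [Real.log_div (lorentzWeightSum_pos q i).ne' (by positivity), Real.log_rpow (by positivity)]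
  rw [h3]
  field_simp
  ring

lemma tendsto_radius_ratio {q r : ℝ} (hq : 1 < q) (hr : 1 < r) :
    Tendsto (fun n : ℕ => (n : ℝ) ^ (1 / q - 1 / r) *
      ((volume (ellrBall r n)).toReal ^ (-(1 : ℝ) / n) /
        (volume (lorentzBall q n)).toReal ^ (-(1 : ℝ) / n))) atTop
      (nhds (Real.exp (1 / q - 1 / r) / (q * (Real.Gamma (1 + 1 / r) * r ^ (1 / r))))) := by
  have hq0 : 0 < q := by linarith
  have hr0 : 0 < r := by linarith
  have hG : 0 < Real.Gamma (1 + 1 / r) := Real.Gamma_pos_of_pos (by positivity)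
  have h1 := ((tendsto_log_Gamma_div_sub_log hr).sub
    (tendsto_log_prod_lorentzWeightSum hq)).sub_const (Real.log (Real.Gamma (1 + 1 / r)))
  have h2 := h1.rexp
  have e : Real.exp (-(1 / r) * (1 + Real.log r) - (Real.log q - 1 / q) -
      Real.log (Real.Gamma (1 + 1 / r))) =
      Real.exp (1 / q - 1 / r) / (q * (Real.Gamma (1 + 1 / r) * r ^ (1 / r))) := by
    rw [Real.rpow_def_of_pos hr0, show -(1 / r) * (1 + Real.log r) - (Real.log q - 1 / q) -
      Real.log (Real.Gamma (1 + 1 / r)) = (1 / q - 1 / r) - (Real.log q +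
      (Real.log (Real.Gamma (1 + 1 / r)) + Real.log r * (1 / r))) by ring, Real.exp_sub,
      Real.exp_add, Real.exp_add, Real.exp_log hq0, Real.exp_log hG]
  rw [e] at h2
  refine h2.congr' ?_
  filter_upwards [eventually_gt_atTop 0] with n hn
  have hn' : (0 : ℝ) < n := by exact_mod_cast hn
  have hB := volume_lorentzBall_toReal_pos q hn.ne'
  have hE := volume_ellrBall_toReal_pos hr hn.ne'
  have hGn : 0 < Real.Gamma ((n : ℝ) / r + 1) := Real.Gamma_pos_of_pos (by positivity)
  have hlB : Real.log (volume (lorentzBall q n)).toReal =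
      n * Real.log 2 - ∑ j ∈ Finset.range n, Real.log (lorentzWeightSum q j) := by
    have hp : 0 < ∏ j : Fin n, (lorentzWeightSum q j)⁻¹ :=
      Finset.prod_pos fun j _ => inv_pos.2 (lorentzWeightSum_pos q j)
    rw [volume_lorentzBall_toReal q hn.ne', Real.log_mul (by positivity) hp.ne', Real.log_pow,
      Fin.prod_univ_eq_prod_range (fun j => (lorentzWeightSum q j)⁻¹), Finset.prod_inv_distrib,
      Real.log_inv, Real.log_prod (fun j _ => (lorentzWeightSum_pos q j).ne'), sub_eq_add_neg]
  have hlE : Real.log (volume (ellrBall r n)).toReal =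
      n * (Real.log 2 + Real.log (Real.Gamma (1 + 1 / r))) -
        Real.log (Real.Gamma ((n : ℝ) / r + 1)) := by
    rw [volume_ellrBall_toReal hr hn.ne', add_comm (1 / r) 1, Real.log_div (by positivity) hGn.ne',
      Real.log_pow, Real.log_mul (by norm_num) hG.ne']
  rw [Real.rpow_def_of_pos hE, Real.rpow_def_of_pos hB, Real.rpow_def_of_pos hn', ← Real.exp_sub,
    ← Real.exp_add, hlB, hlE]
  congr 1
  field_simp
  ring

lemma tendsto_intersectionRadius {q r t : ℝ} (hq : 1 < q) (hr : 1 < r) (ht : 0 < t) :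
    Tendsto (fun n : ℕ => (n : ℝ) ^ (r / q - 1) * intersectionRadius q r t n) atTop
      (nhds ((t * (Real.exp (1 / q - 1 / r) / (q * (Real.Gamma (1 + 1 / r) * r ^ (1 / r))))) ^ r))
      := by
  have hr0 : 0 < r := by linarith
  refine (((tendsto_radius_ratio hq hr).const_mul t).rpow_const (p := r)
    (Or.inr hr0.le)).congr' ?_
  filter_upwards [eventually_gt_atTop 0] with n hn
  have hn' : (0 : ℝ) < n := by exact_mod_cast hn
  rw [intersectionRadius, show r / q - 1 = (1 / q - 1 / r) * r by field_simp,
    Real.rpow_mul hn'.le, ← Real.mul_rpow (by positivity) (by positivity)]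
  congr 1
  ring

lemma tendsto_riemann_sum_of_antitoneOn {F : ℝ → ℝ} (hF : AntitoneOn F (Set.Icc 0 1)) :
    Tendsto (fun n : ℕ => (∑ i ∈ Finset.range n, F (i / n)) / n) atTop
      (nhds (∫ s in (0 : ℝ)..1, F s)) := by
  have hlim : Tendsto (fun n : ℕ => (∫ s in (0 : ℝ)..1, F s) + (F 0 - F 1) / (n : ℝ)) atTop
      (nhds (∫ s in (0 : ℝ)..1, F s)) := by
    simpa using (tendsto_const_div_atTop_nhds_zero_nat (F 0 - F 1)).const_add
      (∫ s in (0 : ℝ)..1, F s)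
  have key : ∀ n : ℕ, 0 < n → (n * ∫ s in (0 : ℝ)..1, F s) ≤ ∑ i ∈ Finset.range n, F (i / n) ∧
      ∑ i ∈ Finset.range n, F (i / n) ≤ (n * ∫ s in (0 : ℝ)..1, F s) + (F 0 - F 1) := by
    intro n hn
    have hn' : (0 : ℝ) < n := by exact_mod_cast hn
    have hanti : AntitoneOn (fun x : ℝ => F (x / n)) (Set.Icc 0 (0 + (n : ℝ))) := by
      intro x hx y hy hxy
      rw [zero_add] at hx hy
      exact hF ⟨div_nonneg hx.1 hn'.le, (div_le_one hn').2 hx.2⟩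
        ⟨div_nonneg hy.1 hn'.le, (div_le_one hn').2 hy.2⟩ (by gcongr)
    have h1 := hanti.integral_le_sum
    have h2 := hanti.sum_le_integral
    simp only [zero_add] at h1 h2
    rw [intervalIntegral.integral_comp_div (f := F) hn'.ne', zero_div, div_self hn'.ne',
      smul_eq_mul] at h1 h2
    refine ⟨h1, ?_⟩
    have h3 := Finset.sum_range_succ' (fun i : ℕ => F ((i : ℝ) / n)) n
    rw [Finset.sum_range_succ, div_self hn'.ne', Nat.cast_zero, zero_div] at h3
    linarith
  refine tendsto_of_tendsto_of_tendsto_of_le_of_le' tendsto_const_nhds hlim ?_ ?_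
  · filter_upwards [eventually_gt_atTop 0] with n hn
    have hn' : (0 : ℝ) < n := by exact_mod_cast hn
    rw [le_div_iff₀ hn', mul_comm]
    exact (key n hn).1
  · filter_upwards [eventually_gt_atTop 0] with n hn
    have hn' : (0 : ℝ) < n := by exact_mod_cast hn
    rw [div_le_iff₀ hn', add_mul, div_mul_cancel₀ _ hn'.ne', mul_comm]
    exact (key n hn).2

lemma integral_rpow_mul_one_sub_rpow {a b : ℝ} (ha : 0 < a) (hb : 0 < b) :
    ∫ u in (0 : ℝ)..1, u ^ (a - 1) * (1 - u) ^ (b - 1) =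
      Real.Gamma a * Real.Gamma b / Real.Gamma (a + b) := by
  have h := ProbabilityTheory.beta_eq_betaIntegralReal a b ha hb
  rw [ProbabilityTheory.beta, Complex.betaIntegral] at h
  rw [h, ← Complex.ofReal_re (∫ u in (0 : ℝ)..1, u ^ (a - 1) * (1 - u) ^ (b - 1)),
    ← intervalIntegral.integral_ofReal]
  congr 1
  refine intervalIntegral.integral_congr fun u hu => ?_
  rw [Set.uIcc_of_le zero_le_one] at hu
  push_cast
  rw [Complex.ofReal_cpow hu.1, Complex.ofReal_cpow (by linarith [hu.2])]
  push_cast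
  rfl

lemma integral_one_sub_rpow_rpow {α r : ℝ} (hα0 : 0 < α) (hα1 : α < 1) (hr : 0 < r) :
    ∫ s in (0 : ℝ)..1, (1 - s ^ α) ^ r =
      Real.Gamma (1 + 1 / α) * Real.Gamma (r + 1) / Real.Gamma (r + 1 + 1 / α) := by
  have hp : 1 < 1 / α := by rw [lt_div_iff₀ hα0]; linarith
  have hsub := intervalIntegral.integral_comp_mul_deriv (a := 0) (b := 1)
    (f := fun u : ℝ => u ^ (1 / α)) (f' := fun u : ℝ => 1 / α * u ^ (1 / α - 1))
    (g := fun s : ℝ => (1 - s ^ α) ^ r)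
    (fun u _ => Real.hasDerivAt_rpow_const (Or.inr hp.le))
    (((Real.continuous_rpow_const (by linarith)).const_mul _).continuousOn)
    ((continuous_const.sub (Real.continuous_rpow_const hα0.le)).rpow_const
      (fun _ => Or.inr hr.le))
  rw [Real.zero_rpow (by positivity), Real.one_rpow] at hsub
  rw [← hsub]
  have h2 : ∫ u in (0 : ℝ)..1, ((fun s : ℝ => (1 - s ^ α) ^ r) ∘ fun u : ℝ => u ^ (1 / α)) u *
      (1 / α * u ^ (1 / α - 1)) =
      ∫ u in (0 : ℝ)..1, 1 / α * (u ^ (1 / α - 1) * (1 - u) ^ (r + 1 - 1)) := by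
    refine intervalIntegral.integral_congr fun u hu => ?_
    rw [Set.uIcc_of_le zero_le_one] at hu
    simp only [Function.comp]
    rw [← Real.rpow_mul hu.1, one_div_mul_cancel hα0.ne', Real.rpow_one, add_sub_cancel_right]
    ring
  rw [h2, intervalIntegral.integral_const_mul,
    integral_rpow_mul_one_sub_rpow (by linarith) (by linarith), add_comm 1 (1 / α),
    Real.Gamma_add_one (s := 1 / α) (by positivity), add_comm (1 / α) (r + 1)]
  ring

lemma tendsto_riemann_sum_profile {α r c : ℝ} (hα0 : 0 < α) (hα1 : α < 1) (hr : 0 < r)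
    (hc : 0 ≤ c) :
    Tendsto (fun n : ℕ => (∑ i ∈ Finset.range n, (c * (1 - ((i : ℝ) / n) ^ α)) ^ r) / n) atTop
      (nhds (c ^ r * (Real.Gamma (1 + 1 / α) * Real.Gamma (r + 1) /
        Real.Gamma (r + 1 + 1 / α)))) := by
  have hanti : AntitoneOn (fun s : ℝ => (c * (1 - s ^ α)) ^ r) (Set.Icc 0 1) := by
    intro x hx y hy hxy
    have h1 : y ^ α ≤ 1 := Real.rpow_le_one hy.1 hy.2 hα0.le
    have h2 : x ^ α ≤ y ^ α := Real.rpow_le_rpow hx.1 hxy hα0.le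
    exact Real.rpow_le_rpow (mul_nonneg hc (by linarith)) (by gcongr) hr.le
  have h := tendsto_riemann_sum_of_antitoneOn hanti
  have e : ∫ s in (0 : ℝ)..1, (c * (1 - s ^ α)) ^ r = c ^ r * ∫ s in (0 : ℝ)..1,
      (1 - s ^ α) ^ r := by
    rw [← intervalIntegral.integral_const_mul]
    refine intervalIntegral.integral_congr fun s hs => ?_
    rw [Set.uIcc_of_le zero_le_one] at hs
    have h1 : s ^ α ≤ 1 := Real.rpow_le_one hs.1 hs.2 hα0.le
    exact Real.mul_rpow hc (by linarith)
  rwa [e, integral_one_sub_rpow_rpow hα0 hα1 hr] at h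

lemma sum_ite_inv_lorentzWeightSum (q : ℝ) {n : ℕ} (i : Fin n) :
    ∑ j : Fin n, (if i ≤ j then (lorentzWeightSum q j)⁻¹ else 0) =
      invWeightSum q n - invWeightSum q i := by
  have h := Fin.sum_univ_eq_sum_range
    (fun j => if (i : ℕ) ≤ j then (lorentzWeightSum q j)⁻¹ else 0) n
  simp only [Fin.le_def]
  rw [h, ← Finset.sum_filter, invWeightSum, invWeightSum, ← Finset.sum_Ico_eq_sub _ i.2.le]
  refine Finset.sum_congr ?_ fun _ _ => rfl
  ext j
  simp only [Finset.mem_filter, Finset.mem_range, Finset.mem_Ico]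
  tauto

lemma tendsto_sq_mul_exp_neg {α k : ℝ} (hα : 0 < α) (hk : 0 < k) (K : ℝ) :
    Tendsto (fun n : ℕ => (n : ℝ) * (K * (n * Real.exp (-k * (n : ℝ) ^ α)))) atTop (nhds 0) := by
  have h := (((tendsto_rpow_mul_exp_neg_mul_atTop_nhds_zero (2 / α) k hk).comp
    (tendsto_natCast_rpow_atTop hα)).const_mul K)
  rw [mul_zero] at h
  refine h.congr fun n => ?_
  simp only [Function.comp]
  rw [← Real.rpow_mul (Nat.cast_nonneg n), mul_div_cancel₀ _ hα.ne', Real.rpow_two]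
  ring

lemma tendsto_volume_coordinate_deviation {q ε : ℝ} (hq : 1 < q) (hε : 0 < ε) :
    Tendsto (fun n : ℕ => n.factorial * (volume (cornerSimplex n ∩ ⋃ i : Fin n,
      {y | ε * (n : ℝ) ^ (1 - 1 / q) ≤ |n * tailMap (lorentzWeightSum q) n y i -
        (invWeightSum q n - invWeightSum q i)|})).toReal) atTop (nhds 0) := by
  have hα : 0 < 1 - 1 / q := by
    have : 1 / q < 1 := by rw [div_lt_one (by linarith)]; exact hq
    linarith
  have hc : 0 < (q - 1)⁻¹ := inv_pos.2 (by linarith)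
  obtain ⟨C, hCdef⟩ : ∃ C, C = (q - 1)⁻¹ + 1 := ⟨_, rfl⟩
  have hC : 0 < C := by linarith
  obtain ⟨τ, hτdef⟩ : ∃ τ, τ = min (1 / 2) (ε / (2 * C)) := ⟨_, rfl⟩
  have hτ0 : 0 < τ := by rw [hτdef]; positivity
  have hτ1 : τ ≤ 1 / 2 := by rw [hτdef]; exact min_le_left _ _
  have hτ2 : τ * C ≤ ε / 2 := by
    have : τ ≤ ε / (2 * C) := by rw [hτdef]; exact min_le_right _ _
    rw [le_div_iff₀ (by positivity)] at this
    linarith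
  refine squeeze_zero' (Eventually.of_forall fun n => by positivity) ?_
    (tendsto_sq_mul_exp_neg hα (k := τ * ε / 2) (by positivity) (2 * Real.exp 1))
  filter_upwards [eventually_invWeightSum_close hq one_pos, eventually_gt_atTop 0] with n hn hn0
  have hS : invWeightSum q n ≤ C * (n : ℝ) ^ (1 - 1 / q) := by
    have := (abs_le.1 (hn n le_rfl)).2
    rw [hCdef]
    linarith
  have hone : ∀ i : Fin n, (n.factorial : ℝ) * (volume (cornerSimplex n ∩
      {y | ε * (n : ℝ) ^ (1 - 1 / q) ≤ |n * tailMap (lorentzWeightSum q) n y i -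
        (invWeightSum q n - invWeightSum q i)|})).toReal ≤
      2 * Real.exp 1 * (n * Real.exp (-(τ * ε / 2) * (n : ℝ) ^ (1 - 1 / q))) := by
    intro i
    have hS' : invWeightSum q n - invWeightSum q i ≤ C * (n : ℝ) ^ (1 - 1 / q) := by
      have : 0 ≤ invWeightSum q i :=
        Finset.sum_nonneg fun j _ => (inv_pos.2 (lorentzWeightSum_pos q j)).le
      linarith
    have h := volume_simplex_deviation_le hn0.ne'
      (a := fun j : Fin n => if i ≤ j then (lorentzWeightSum q j)⁻¹ else 0)
      (fun j => by
        split_ifs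
        exacts [(inv_pos.2 (lorentzWeightSum_pos q j)).le, le_rfl])
      (fun j => by
        split_ifs
        exacts [inv_le_one_of_one_le₀ (one_le_lorentzWeightSum q j), zero_le_one])
      hτ0 hτ1 (ε * (n : ℝ) ^ (1 - 1 / q))
    simp only [← tailMap_apply (lorentzWeightSum q), sum_ite_inv_lorentzWeightSum] at h
    refine h.trans ?_
    rw [mul_assoc (Real.exp 1), ← mul_assoc 2]
    gcongr
    have h5 : 0 ≤ (n : ℝ) ^ (1 - 1 / q) := by positivity
    calc τ ^ 2 * (invWeightSum q n - invWeightSum q i) - τ * (ε * (n : ℝ) ^ (1 - 1 / q))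
        ≤ τ ^ 2 * (C * (n : ℝ) ^ (1 - 1 / q)) - τ * (ε * (n : ℝ) ^ (1 - 1 / q)) := by gcongr
      _ = τ * (n : ℝ) ^ (1 - 1 / q) * (τ * C) - τ * (ε * (n : ℝ) ^ (1 - 1 / q)) := by ring
      _ ≤ τ * (n : ℝ) ^ (1 - 1 / q) * (ε / 2) - τ * (ε * (n : ℝ) ^ (1 - 1 / q)) := by gcongr
      _ = -(τ * ε / 2) * (n : ℝ) ^ (1 - 1 / q) := by ring
  rw [Set.inter_iUnion]
  calc _ ≤ (n.factorial : ℝ) * ∑ i : Fin n, (volume (cornerSimplex n ∩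
      {y | ε * (n : ℝ) ^ (1 - 1 / q) ≤ |n * tailMap (lorentzWeightSum q) n y i -
        (invWeightSum q n - invWeightSum q i)|})).toReal := by
        gcongr
        exact measureReal_iUnion_fintype_le _
    _ ≤ ∑ _i : Fin n, 2 * Real.exp 1 * (n * Real.exp (-(τ * ε / 2) * (n : ℝ) ^ (1 - 1 / q))) := by
        rw [Finset.mul_sum]
        exact Finset.sum_le_sum fun i _ => hone i
    _ = _ := by simp

lemma exists_abs_rpow_close {c r η : ℝ} (hr : 0 < r) (hη : 0 < η) :
    ∃ ε > 0, ∀ a, 0 ≤ a → a ≤ c → ∀ x, |x - a| ≤ ε → |(|x| ^ r) - a ^ r| ≤ η := by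
  have hcont : ContinuousOn (fun x : ℝ => |x| ^ r) (Set.Icc (-1) (c + 1)) :=
    (continuous_abs.rpow_const fun _ => Or.inr hr.le).continuousOn
  have huc := isCompact_Icc.uniformContinuousOn_of_continuous hcont
  obtain ⟨δ, hδ, h⟩ := Metric.uniformContinuousOn_iff.1 huc η hη
  refine ⟨min (δ / 2) 1, by positivity, fun a ha hac x hx => ?_⟩
  have h1 := abs_le.1 (hx.trans (min_le_right _ _))
  have h2 := hx.trans (min_le_left _ _)
  have h3 := h x ⟨by linarith, by linarith⟩ a ⟨by linarith, by linarith⟩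
    (by rw [Real.dist_eq]; linarith)
  rw [Real.dist_eq, abs_of_nonneg ha] at h3
  exact h3.le

lemma abs_scaled_coordinate_sub_le {q ε x : ℝ} (hq : 1 < q) {n i : ℕ} (hn : 0 < n) (hi : i ≤ n)
    (hclose : ∀ m ≤ n, |invWeightSum q m - (q - 1)⁻¹ * (m : ℝ) ^ (1 - 1 / q)| ≤
      ε * (n : ℝ) ^ (1 - 1 / q))
    (hx : |n * x - (invWeightSum q n - invWeightSum q i)| ≤ ε * (n : ℝ) ^ (1 - 1 / q)) :
    |(n : ℝ) ^ (1 / q) * x - (q - 1)⁻¹ * (1 - ((i : ℝ) / n) ^ (1 - 1 / q))| ≤ 3 * ε := by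
  have hn' : (0 : ℝ) < n := by exact_mod_cast hn
  have hN : 0 < (n : ℝ) ^ (1 - 1 / q) := by positivity
  have e1 : (n : ℝ) = (n : ℝ) ^ (1 / q) * (n : ℝ) ^ (1 - 1 / q) := by
    rw [← Real.rpow_add hn']
    simp
  have e2 : n * x - (q - 1)⁻¹ * ((n : ℝ) ^ (1 - 1 / q) - (i : ℝ) ^ (1 - 1 / q)) =
      ((n : ℝ) ^ (1 / q) * x - (q - 1)⁻¹ * (1 - ((i : ℝ) / n) ^ (1 - 1 / q))) *
        (n : ℝ) ^ (1 - 1 / q) := by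
    rw [Real.div_rpow (Nat.cast_nonneg i) hn'.le]
    nth_rewrite 1 [e1]
    field_simp
  have h1 := abs_le.1 (hclose n le_rfl)
  have h2 := abs_le.1 (hclose i hi)
  have h3 := abs_le.1 hx
  have h4 : |n * x - (q - 1)⁻¹ * ((n : ℝ) ^ (1 - 1 / q) - (i : ℝ) ^ (1 - 1 / q))| ≤
      3 * ε * (n : ℝ) ^ (1 - 1 / q) := by
    rw [mul_sub]
    exact abs_le.2 ⟨by linarith, by linarith⟩
  rw [e2, abs_mul, abs_of_pos hN] at h4
  exact le_of_mul_le_mul_right h4 hN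

lemma tendsto_volume_powerSum_deviation {q r η : ℝ} (hq : 1 < q) (hr : 1 < r) (hη : 0 < η) :
    Tendsto (fun n : ℕ => n.factorial * (volume (cornerSimplex n ∩
      {y | η ≤ |(n : ℝ) ^ (r / q - 1) * ∑ i, |tailMap (lorentzWeightSum q) n y i| ^ r -
        ((q - 1)⁻¹) ^ r * (Real.Gamma (1 + q / (q - 1)) * Real.Gamma (r + 1) /
          Real.Gamma (r + 1 + q / (q - 1)))|})).toReal) atTop (nhds 0) := by
  have hr0 : 0 < r := by linarith
  have hq0 : 0 < q := by linarith
  have hq1 : 0 < q - 1 := by linarith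
  have hqi : 0 < 1 / q := by positivity
  have hα : 0 < 1 - 1 / q := by
    have : 1 / q < 1 := by rw [div_lt_one hq0]; exact hq
    linarith
  have hc : 0 < (q - 1)⁻¹ := inv_pos.2 hq1
  have hp : 1 / (1 - 1 / q) = q / (q - 1) := by field_simp
  have hR := tendsto_riemann_sum_profile hα (by linarith) hr0 hc.le
  rw [hp] at hR
  set L := ((q - 1)⁻¹) ^ r * (Real.Gamma (1 + q / (q - 1)) * Real.Gamma (r + 1) /
          Real.Gamma (r + 1 + q / (q - 1))) with hL
  obtain ⟨ε, hε, hεη⟩ := exists_abs_rpow_close (c := (q - 1)⁻¹) hr0 (half_pos (half_pos hη))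
  refine squeeze_zero' (Eventually.of_forall fun n => by positivity) ?_
    (tendsto_volume_coordinate_deviation hq (ε := ε / 3) (by positivity))
  filter_upwards [eventually_gt_atTop 0, eventually_invWeightSum_close hq (ε := ε / 3)
    (by positivity), Metric.tendsto_nhds.1 hR (η / 2) (half_pos hη)] with n hn hclose hRn
  have hn' : (0 : ℝ) < n := by exact_mod_cast hn
  rw [Real.dist_eq] at hRn
  have hsub : cornerSimplex n ∩
      {y | η ≤ |(n : ℝ) ^ (r / q - 1) * ∑ i, |tailMap (lorentzWeightSum q) n y i| ^ r - L|} ⊆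
      cornerSimplex n ∩ ⋃ i : Fin n,
      {y | ε / 3 * (n : ℝ) ^ (1 - 1 / q) ≤ |n * tailMap (lorentzWeightSum q) n y i -
        (invWeightSum q n - invWeightSum q i)|} := by
    rintro y ⟨hy, hyη⟩
    refine ⟨hy, ?_⟩
    by_contra hcon
    simp only [Set.mem_iUnion, Set.mem_ofPred_eq, not_exists, not_le] at hcon hyη
    have hterm : ∀ i : Fin n, |(n : ℝ) ^ (r / q) * |tailMap (lorentzWeightSum q) n y i| ^ r -
        ((q - 1)⁻¹ * (1 - (((i : ℕ) : ℝ) / n) ^ (1 - 1 / q))) ^ r| ≤ η / 2 / 2 := by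
      intro i
      have h1 := abs_scaled_coordinate_sub_le hq hn i.2.le hclose (hcon i).le
      have hi1 : ((i : ℕ) : ℝ) / n ≤ 1 := by
        rw [div_le_one hn']
        exact_mod_cast i.2.le
      have h2 : (((i : ℕ) : ℝ) / n) ^ (1 - 1 / q) ≤ 1 :=
        Real.rpow_le_one (by positivity) hi1 hα.le
      have h3 : 0 ≤ (((i : ℕ) : ℝ) / n) ^ (1 - 1 / q) := by positivity
      have h4 := hεη _ (mul_nonneg hc.le (by linarith)) (mul_le_of_le_one_right hc.le (by linarith))
        _ (h1.trans (by linarith))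
      rwa [abs_mul, abs_of_pos (a := (n : ℝ) ^ (1 / q)) (by positivity),
        Real.mul_rpow (by positivity) (abs_nonneg _), ← Real.rpow_mul hn'.le,
        one_div_mul_eq_div] at h4
    have hsum : |(n : ℝ) ^ (r / q - 1) * ∑ i, |tailMap (lorentzWeightSum q) n y i| ^ r -
        (∑ i ∈ Finset.range n, ((q - 1)⁻¹ * (1 - ((i : ℝ) / n) ^ (1 - 1 / q))) ^ r) / n| ≤
        η / 2 / 2 := by
      rw [← Fin.sum_univ_eq_sum_range
        (fun i => ((q - 1)⁻¹ * (1 - ((i : ℝ) / n) ^ (1 - 1 / q))) ^ r),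
        Real.rpow_sub_one hn'.ne', div_mul_eq_mul_div, Finset.mul_sum, ← sub_div,
        ← Finset.sum_sub_distrib, abs_div, abs_of_pos hn', div_le_iff₀ hn']
      refine (Finset.abs_sum_le_sum_abs _ _).trans ((Finset.sum_le_sum fun i _ => hterm i).trans ?_)
      simp [mul_comm]
    have := abs_sub_le ((n : ℝ) ^ (r / q - 1) * ∑ i, |tailMap (lorentzWeightSum q) n y i| ^ r)
      ((∑ i ∈ Finset.range n, ((q - 1)⁻¹ * (1 - ((i : ℝ) / n) ^ (1 - 1 / q))) ^ r) / n) L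
    linarith
  gcongr
  refine ne_top_of_le_ne_top ?_ (measure_mono Set.inter_subset_left)
  rw [volume_cornerSimplex hn.ne']
  exact ENNReal.ofReal_ne_top

lemma Aqr_mul_rpow_mul {q r t : ℝ} (hq : 1 < q) (hr : 1 < r) (ht : 0 < t) :
    (Aqr q r * t) ^ r * (((q - 1)⁻¹) ^ r * (Real.Gamma (1 + q / (q - 1)) * Real.Gamma (r + 1) /
      Real.Gamma (r + 1 + q / (q - 1)))) =
      (t * (Real.exp (1 / q - 1 / r) / (q * (Real.Gamma (1 + 1 / r) * r ^ (1 / r))))) ^ r := by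
  have hr0 : 0 < r := by linarith
  have hq0 : 0 < q := by linarith
  have hq1 : 0 < q - 1 := by linarith
  have hG : 0 < Real.Gamma (1 + 1 / r) := Real.Gamma_pos_of_pos (by positivity)
  have hG1 : 0 < Real.Gamma (1 + q / (q - 1)) := Real.Gamma_pos_of_pos (by positivity)
  have hG2 : 0 < Real.Gamma (r + 1) := Real.Gamma_pos_of_pos (by positivity)
  have hG3 : 0 < Real.Gamma (r + 1 + q / (q - 1)) := Real.Gamma_pos_of_pos (by positivity)
  have hX : 0 < Real.Gamma (r + 1 + q / (q - 1)) /
      (Real.Gamma (r + 1) * Real.Gamma (1 + q / (q - 1))) := by positivity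
  have e : Aqr q r * t = t * (Real.exp (1 / q - 1 / r) /
      (q * (Real.Gamma (1 + 1 / r) * r ^ (1 / r)))) * (q - 1) *
      (Real.Gamma (r + 1 + q / (q - 1)) /
        (Real.Gamma (r + 1) * Real.Gamma (1 + q / (q - 1)))) ^ (1 / r) := by
    rw [Aqr]
    field_simp
  rw [e, Real.mul_rpow (by positivity) (by positivity), Real.mul_rpow (by positivity) hq1.le,
    ← Real.rpow_mul hX.le, one_div_mul_cancel hr0.ne', Real.rpow_one, Real.inv_rpow hq1.le]
  have : 0 < (q - 1) ^ r := by positivity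
  field_simp

lemma Aqr_mul_pos {q r t : ℝ} (hq : 1 < q) (hr : 1 < r) (ht : 0 < t) : 0 < Aqr q r * t := by
  have hq1 : 0 < q - 1 := by linarith
  have hG : 0 < Real.Gamma (1 + 1 / r) := Real.Gamma_pos_of_pos (by positivity)
  have hG1 : 0 < Real.Gamma (1 + q / (q - 1)) := Real.Gamma_pos_of_pos (by positivity)
  have hG2 : 0 < Real.Gamma (r + 1) := Real.Gamma_pos_of_pos (by positivity)
  have hG3 : 0 < Real.Gamma (r + 1 + q / (q - 1)) := Real.Gamma_pos_of_pos (by positivity)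
  rw [Aqr]
  positivity

lemma cornerSimplex_inter_ne_top {n : ℕ} (hn : n ≠ 0) (A : Set (Fin n → ℝ)) :
    volume (cornerSimplex n ∩ A) ≠ ⊤ := by
  refine ne_top_of_le_ne_top ?_ (measure_mono Set.inter_subset_left)
  rw [volume_cornerSimplex hn]
  exact ENNReal.ofReal_ne_top

lemma factorial_mul_volume_cornerSimplex_inter_le_one {n : ℕ} (hn : n ≠ 0)
    (A : Set (Fin n → ℝ)) : n.factorial * (volume (cornerSimplex n ∩ A)).toReal ≤ 1 := by
  have hf : (0 : ℝ) < n.factorial := by exact_mod_cast n.factorial_pos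
  have h : (volume (cornerSimplex n ∩ A)).toReal ≤ (n.factorial : ℝ)⁻¹ := by
    rw [← ENNReal.toReal_ofReal (inv_pos.2 hf).le, ← volume_cornerSimplex hn]
    refine ENNReal.toReal_mono ?_ (measure_mono Set.inter_subset_left)
    rw [volume_cornerSimplex hn]
    exact ENNReal.ofReal_ne_top
  calc _ ≤ (n.factorial : ℝ) * (n.factorial : ℝ)⁻¹ := by gcongr
    _ = 1 := mul_inv_cancel₀ hf.ne'

lemma one_le_factorial_mul_volume_add {n : ℕ} (hn : n ≠ 0) {A B : Set (Fin n → ℝ)}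
    (hAB : A ∪ B = Set.univ) : 1 ≤ n.factorial * (volume (cornerSimplex n ∩ A)).toReal +
      n.factorial * (volume (cornerSimplex n ∩ B)).toReal := by
  have hf : (0 : ℝ) < n.factorial := by exact_mod_cast n.factorial_pos
  have h : (n.factorial : ℝ)⁻¹ ≤ (volume (cornerSimplex n ∩ A)).toReal +
      (volume (cornerSimplex n ∩ B)).toReal := by
    rw [← ENNReal.toReal_add (cornerSimplex_inter_ne_top hn A) (cornerSimplex_inter_ne_top hn B),
      ← ENNReal.toReal_ofReal (inv_pos.2 hf).le, ← volume_cornerSimplex hn]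
    refine ENNReal.toReal_mono (ENNReal.add_ne_top.2
      ⟨cornerSimplex_inter_ne_top hn A, cornerSimplex_inter_ne_top hn B⟩) ?_
    refine le_trans (le_of_eq ?_) (measure_union_le _ _)
    rw [← Set.inter_union_distrib_left, hAB, Set.inter_univ]
  rw [← mul_add]
  calc (1 : ℝ) = n.factorial * (n.factorial : ℝ)⁻¹ := (mul_inv_cancel₀ hf.ne').symm
    _ ≤ _ := by gcongr

section Threshold

variable {L R : ℝ} {f : (n : ℕ) → (Fin n → ℝ) → ℝ} {ρ s : ℕ → ℝ}

lemma tendsto_volume_sublevel_one (hs : ∀ n, n ≠ 0 → 0 < s n)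
    (hρ : Tendsto (fun n => s n * ρ n) atTop (nhds R)) (hLR : L < R)
    (hf : ∀ η > 0, Tendsto (fun n : ℕ => n.factorial * (volume (cornerSimplex n ∩
      {y | η ≤ |s n * f n y - L|})).toReal) atTop (nhds 0)) :
    Tendsto (fun n : ℕ => n.factorial * (volume (cornerSimplex n ∩
      {y | f n y ≤ ρ n})).toReal) atTop (nhds 1) := by
  have hη : 0 < (R - L) / 2 := by linarith
  have hlow : Tendsto (fun n : ℕ => 1 - n.factorial * (volume (cornerSimplex n ∩
      {y | (R - L) / 2 ≤ |s n * f n y - L|})).toReal) atTop (nhds 1) := by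
    simpa using (hf _ hη).const_sub 1
  refine tendsto_of_tendsto_of_tendsto_of_le_of_le' hlow tendsto_const_nhds ?_ ?_
  · filter_upwards [eventually_ne_atTop 0,
      hρ.eventually_const_lt (u := L + (R - L) / 2) (by linarith)] with n hn hρn
    rw [sub_le_iff_le_add]
    refine one_le_factorial_mul_volume_add hn (Set.eq_univ_of_forall fun y => ?_)
    by_cases hy : f n y ≤ ρ n
    · exact Or.inl hy
    · refine Or.inr ?_
      have h1 : s n * ρ n < s n * f n y := mul_lt_mul_of_pos_left (not_le.1 hy) (hs n hn)
      change (R - L) / 2 ≤ |s n * f n y - L|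
      exact le_trans (by linarith) (le_abs_self _)
  · filter_upwards [eventually_ne_atTop 0] with n hn
    exact factorial_mul_volume_cornerSimplex_inter_le_one hn _

lemma tendsto_volume_sublevel_zero (hs : ∀ n, n ≠ 0 → 0 < s n)
    (hρ : Tendsto (fun n => s n * ρ n) atTop (nhds R)) (hLR : R < L)
    (hf : ∀ η > 0, Tendsto (fun n : ℕ => n.factorial * (volume (cornerSimplex n ∩
      {y | η ≤ |s n * f n y - L|})).toReal) atTop (nhds 0)) :
    Tendsto (fun n : ℕ => n.factorial * (volume (cornerSimplex n ∩
      {y | f n y ≤ ρ n})).toReal) atTop (nhds 0) := by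
  refine squeeze_zero' (Eventually.of_forall fun n => by positivity) ?_
    (hf ((L - R) / 2) (by linarith))
  filter_upwards [eventually_ne_atTop 0,
    hρ.eventually_lt_const (u := L - (L - R) / 2) (by linarith)] with n hn hρn
  have hsub : cornerSimplex n ∩ {y | f n y ≤ ρ n} ⊆
      cornerSimplex n ∩ {y | (L - R) / 2 ≤ |s n * f n y - L|} := by
    refine Set.inter_subset_inter_right _ fun y (hy : f n y ≤ ρ n) => ?_
    have h1 : s n * f n y ≤ s n * ρ n := mul_le_mul_of_nonneg_left hy (hs n hn).le
    change (L - R) / 2 ≤ |s n * f n y - L|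
    exact le_trans (by linarith) (neg_le_abs _)
  exact mul_le_mul_of_nonneg_left (ENNReal.toReal_mono (cornerSimplex_inter_ne_top hn _)
    (measure_mono hsub)) (Nat.cast_nonneg _)

end Threshold

/-- Schechtman–Schmuckenschläger type result: the volume of the intersection of the
volume-normalized Lorentz ball and the dilated volume-normalized `ℓ_r^n` ball tends to
`1` if `A_{q,r} t > 1` and to `0` if `A_{q,r} t < 1`. -/
theorem volume_intersection_threshold (q : ℝ) (hq : 1 < q) (r : ℝ) (hr : 1 < r)
    (t : ℝ) (ht : 0 < t) :
    (1 < Aqr q r * t →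
      Tendsto (fun n : ℕ =>
          (volume (volNormLorentzBall q n ∩ (fun x => t • x) '' volNormEllrBall r n)).toReal)
        atTop (nhds 1))
    ∧ (Aqr q r * t < 1 →
      Tendsto (fun n : ℕ =>
          (volume (volNormLorentzBall q n ∩ (fun x => t • x) '' volNormEllrBall r n)).toReal)
        atTop (nhds 0)) := by
  have hr0 : 0 < r := by linarith
  have hq1 : 0 < q - 1 := by linarith
  have hA := Aqr_mul_pos hq hr ht
  have hL : 0 < ((q - 1)⁻¹) ^ r * (Real.Gamma (1 + q / (q - 1)) * Real.Gamma (r + 1) /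
      Real.Gamma (r + 1 + q / (q - 1))) := by
    have hG1 : 0 < Real.Gamma (1 + q / (q - 1)) := Real.Gamma_pos_of_pos (by positivity)
    have hG2 : 0 < Real.Gamma (r + 1) := Real.Gamma_pos_of_pos (by positivity)
    have hG3 : 0 < Real.Gamma (r + 1 + q / (q - 1)) := Real.Gamma_pos_of_pos (by positivity)
    positivity
  have hρ := tendsto_intersectionRadius hq hr ht
  rw [← Aqr_mul_rpow_mul hq hr ht] at hρ
  have hs : ∀ n : ℕ, n ≠ 0 → 0 < (n : ℝ) ^ (r / q - 1) := fun n hn => by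
    have : (0 : ℝ) < n := by exact_mod_cast Nat.pos_of_ne_zero hn
    positivity
  have hdev := fun (η : ℝ) (hη : 0 < η) => tendsto_volume_powerSum_deviation hq hr hη
  constructor
  · intro h
    refine (tendsto_volume_sublevel_one
      (f := fun n y => ∑ i, |tailMap (lorentzWeightSum q) n y i| ^ r) hs hρ
      (lt_mul_of_one_lt_left hL (Real.one_lt_rpow h hr0)) hdev).congr' ?_
    filter_upwards [eventually_ne_atTop 0] with n hn
    exact (volume_inter_toReal q hr ht hn).symm
  · intro h
    refine (tendsto_volume_sublevel_zero
      (f := fun n y => ∑ i, |tailMap (lorentzWeightSum q) n y i| ^ r) hs hρ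
      (mul_lt_of_lt_one_left hL (Real.rpow_lt_one hA.le h hr0)) hdev).congr' ?_
    filter_upwards [eventually_ne_atTop 0] with n hn
    exact (volume_inter_toReal q hr ht hn).symm

end
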